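/- Let n = 2m be even and 0 ≤ k ≤ m−1. Then ⟨Pf^{−2k}⟩_D = ⋃_{e≥1} 𝒩_{k,e}, i.e. the D_X-module ⟨Pf^{−2k}⟩_D is the direct limit over e of the S-modules 𝒩_{k,e} inside Frac(S). Moreover, for 0 ≤ k ≤ m−2 the inclusion ⟨Pf^{−2k}⟩_D ↪ ⟨Pf^{−2k−2}⟩_D is the direct limit of the inclusions 𝒩_{k,e} ⊆ 𝒩_{k+1,e}. -/

import Mathlib

/-!
Common setup: the polynomial ring `S = ℂ[x_{i,j}]` of the space
`X = ⋀² (ℂⁿ)*` of `n × n` complex skew-symmetric matrices, Pfaffians, the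
`GL_n(ℂ)`-action, invariant ideals, Pfaffian varieties and their (radical)
vanishing ideals, local cohomology (Mathlib's `localCohomology`), the
localization `S_Pf`, 𝒟-module spans in `S_Pf` (via the partial derivatives,
extended to `S_Pf` as derivations), Gaussian binomial coefficients, and
injective-hull data for `E = E(ℂ)`.
-/

open scoped BigOperators

noncomputable section

namespace SkewLC

/-- Indices `(i,j)` with `i < j`, labelling the variables `x_{i,j}`. -/
abbrev SkewIdx (n : ℕ) := {p : Fin n × Fin n // p.1 < p.2}

/-- `S = Sym(⋀² ℂ^n) ≅ ℂ[x_{i,j} : 1 ≤ i < j ≤ n]`. -/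
abbrev PS (n : ℕ) := MvPolynomial (SkewIdx n) ℂ

/-- The `(i,j)` entry of the generic skew-symmetric matrix `(x_{i,j})`. -/
def genEntry (n : ℕ) (i j : Fin n) : PS n :=
  if h : i < j then MvPolynomial.X ⟨(i, j), h⟩
  else if h' : j < i then - MvPolynomial.X ⟨(j, i), h'⟩
  else 0

/-- The Pfaffian of the principal `2r × 2r` block of the generic skew-symmetric
matrix (zero by convention if `2r > n`):
`Pf_r = (1/(2^r r!)) ∑_σ sign(σ) ∏_i x_{σ(2i-1) σ(2i)}`. -/
def pfBlock (n r : ℕ) : PS n :=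
  if h : 2 * r ≤ n then
    (((2 ^ r * r.factorial : ℕ) : ℂ))⁻¹ •
      ∑ σ : Equiv.Perm (Fin (2 * r)),
        (Equiv.Perm.sign σ : ℤ) •
          ∏ i : Fin r,
            genEntry n (Fin.castLE h (σ ⟨2 * i.1, by have := i.isLt; omega⟩))
              (Fin.castLE h (σ ⟨2 * i.1 + 1, by have := i.isLt; omega⟩))
  else 0

/-- The full `n × n` Pfaffian `Pf` (for `n` even). -/
def pfaffian (n : ℕ) : PS n := pfBlock n (n / 2)

/-- The action of an `n × n` matrix `g` on `S`, sending the generic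
skew-symmetric matrix `X` to `g X gᵀ` (on variables,
`x_{ij} ↦ ∑_{a,b} g_{ia} g_{jb} x_{ab}`).  Restricted to invertible `g` this
is the natural action of `GL_n(ℂ)` on `S`. -/
def glMap (n : ℕ) (g : Matrix (Fin n) (Fin n) ℂ) : PS n →ₐ[ℂ] PS n :=
  MvPolynomial.aeval fun p : SkewIdx n =>
    ∑ a : Fin n, ∑ b : Fin n, (g p.1.1 a * g p.1.2 b) • genEntry n a b

/-- `z : ℕ → ℕ` is a partition with at most `m` nonzero parts, recorded as the
(0-indexed) weakly decreasing sequence `z 0 ≥ z 1 ≥ ⋯`; so `z i` is the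
`(i+1)`-st part `z_{i+1}` of the partition. -/
def IsPartition (m : ℕ) (z : ℕ → ℕ) : Prop :=
  (∀ i j, i ≤ j → z j ≤ z i) ∧ ∀ i, m ≤ i → z i = 0

/-- The rectangular partition `a × b` (`a` parts equal to `b`). -/
def rect (a b : ℕ) : ℕ → ℕ := fun i => if i < a then b else 0

/-- The highest weight vector of the irreducible summand
`𝕊_{z^{(2)}} W ⊆ S`: the product `∏_i Pf_i^{z_i - z_{i+1}}` of powers of the
principal `2i × 2i` Pfaffians. -/
def hwVector (n : ℕ) (z : ℕ → ℕ) : PS n :=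
  ∏ i ∈ Finset.range (n / 2), pfBlock n (i + 1) ^ (z i - z (i + 1))

/-- The `GL_n(ℂ)`-invariant ideal `I_z ⊆ S` generated by the irreducible
subrepresentation `𝕊_{z^{(2)}} W` of `S`; since that irreducible is spanned by
the `GL`-orbit of its highest weight vector, `I_z` is the ideal generated by
the `GL_n(ℂ)`-orbit of `hwVector n z`. -/
def invIdeal (n : ℕ) (z : ℕ → ℕ) : Ideal (PS n) :=
  Ideal.span {f | ∃ g : Matrix.GeneralLinearGroup (Fin n) ℂ,
    f = glMap n g.val (hwVector n z)}

/-- The Pfaffian variety `O̅_k`: skew-symmetric `n × n` matrices of rank `≤ 2k`. -/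
def rankVariety (n k : ℕ) : Set (Matrix (Fin n) (Fin n) ℂ) :=
  {A | A.transpose = -A ∧ A.rank ≤ 2 * k}

/-- Evaluation of a polynomial in `S` at a matrix. -/
def evalMat (n : ℕ) (A : Matrix (Fin n) (Fin n) ℂ) : PS n →+* ℂ :=
  (MvPolynomial.aeval fun p : SkewIdx n => A p.1.1 p.1.2).toRingHom

/-- The (radical) vanishing ideal of the Pfaffian variety `O̅_k`; local
cohomology with support in `O̅_k` is local cohomology at this ideal. -/
def varIdeal (n k : ℕ) : Ideal (PS n) :=
  ⨅ A ∈ rankVariety n k, RingHom.ker (evalMat n A)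

/-- The homogeneous maximal ideal `𝔪 ⊆ S` (the vanishing ideal of the origin);
`H^j_{{0}}(-) = H^j_𝔪(-)`. -/
def mIdeal (n : ℕ) : Ideal (PS n) :=
  RingHom.ker (evalMat n 0)

/-- The Gaussian binomial coefficient evaluated at `q^e`,
`binom(a,b)_{q^e} ∈ ℤ[q] ⊆ ℚ[q]`, where
`binom(a,b)_q = ∏_{i=1}^{b} (1 - q^{a-b+i})/(1 - q^i)`.
(The polynomial division below is exact.) -/
def gaussBinom (a b e : ℕ) : Polynomial ℚ :=
  (∏ i ∈ Finset.range b, (1 - Polynomial.X ^ (e * (a - b + i + 1)))) /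
    (∏ i ∈ Finset.range b, (1 - Polynomial.X ^ (e * (i + 1))))

/-- Data exhibiting `E` as the injective hull of `ℂ = S/𝔪` over `S`: an
injective `S`-module together with an essential embedding of `S/𝔪`. -/
structure InjHullData (n : ℕ) where
  /-- the underlying module -/
  E : Type
  [addCommGroup : AddCommGroup E]
  [module : Module (PS n) E]
  injective : Module.Injective (PS n) E
  emb : (PS n ⧸ mIdeal n) →ₗ[PS n] E
  emb_injective : Function.Injective emb
  essential : ∀ N : Submodule (PS n) E, N ≠ ⊥ → N ⊓ LinearMap.range emb ≠ ⊥

attribute [instance] InjHullData.addCommGroup InjHullData.module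

/-- `S_Pf`, the localization of `S` at the Pfaffian. -/
abbrev SPf (n : ℕ) : Type := Localization.Away (pfaffian n)

/-- `Pf⁻¹ ∈ S_Pf`. -/
def pfInv (n : ℕ) : SPf n := IsLocalization.Away.invSelf (S := SPf n) (pfaffian n)

/-- An `S`-submodule of `S_Pf` is a `𝒟_X`-submodule iff it is stable under the
partial derivatives `∂/∂x_{ij}` (extended to `S_Pf`, as the family `δ`). -/
def DStable (n : ℕ) (δ : SkewIdx n → Derivation ℂ (SPf n) (SPf n))
    (N : Submodule (PS n) (SPf n)) : Prop :=
  ∀ p : SkewIdx n, ∀ x ∈ N, δ p x ∈ N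

/-- `⟨v⟩_𝒟 ⊆ S_Pf`, the `𝒟_X`-submodule of `S_Pf` generated by `v`: the
smallest `S`-submodule containing `v` and stable under all partial
derivatives. -/
def dSpan (n : ℕ) (δ : SkewIdx n → Derivation ℂ (SPf n) (SPf n)) (v : SPf n) :
    Submodule (PS n) (SPf n) :=
  sInf {N : Submodule (PS n) (SPf n) | v ∈ N ∧ DStable n δ N}

/-- The statement that `δ` is the family of partial derivatives `∂/∂x_{ij}` of
`S` extended to derivations of `S_Pf` (such an extension exists and is
unique). -/
def IsDerivExtension (n : ℕ) (δ : SkewIdx n → Derivation ℂ (SPf n) (SPf n)) : Prop :=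
  ∀ (p : SkewIdx n) (f : PS n),
    δ p (algebraMap (PS n) (SPf n) f) = algebraMap (PS n) (SPf n) (MvPolynomial.pderiv p f)

/-- For `n = 2m` and `0 ≤ p ≤ m - 1`, the indecomposable equivariant
`𝒟_X`-module `Q_p = S_Pf / ⟨Pf^{2(p-m+1)}⟩_𝒟 = S_Pf / ⟨Pf^{-2(m-1-p)}⟩_𝒟`. -/
abbrev QMod (n : ℕ) (δ : SkewIdx n → Derivation ℂ (SPf n) (SPf n)) (p : ℕ) :=
  SPf n ⧸ dSpan n δ (pfInv n ^ (2 * (n / 2 - 1 - p)))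

/-- The `S`-submodule `𝒩_{k,e} = I_{(m-k) × e} ⊗_S 𝒫_{-e-2k} ⊆ S_Pf`
(`m = n/2`), i.e. the image of the invariant ideal `I_{(m-k) × e}` under
multiplication by `Pf^{-e-2k}`. -/
def NMod (n k e : ℕ) : Submodule (PS n) (SPf n) :=
  Submodule.map
    ((LinearMap.mulLeft (PS n) (pfInv n ^ (e + 2 * k))).comp
      (Algebra.linearMap (PS n) (SPf n)))
    (invIdeal n (rect (n / 2 - k) e))

/-- The set `succ(z, l, m)` of partitions obtained from `z` by adding boxes in
row `l + 1` or higher (rows recorded 0-indexed: `y i > z i` for some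
`l ≤ i < m`). -/
def succSet (m : ℕ) (z : ℕ → ℕ) (l : ℕ) : Set (ℕ → ℕ) :=
  {y | IsPartition m y ∧ (∀ i, z i ≤ y i) ∧ ∃ i, l ≤ i ∧ i < m ∧ z i < y i}

/-- The ideal `I_{succ(z,l,m)} = ∑_{y ∈ succ(z,l,m)} I_y`. -/
def succIdeal (n : ℕ) (z : ℕ → ℕ) (l : ℕ) : Ideal (PS n) :=
  ⨆ y ∈ succSet (n / 2) z l, invIdeal n y

/-- The subquotient `J_{z,l} = I_z / I_{succ(z,l,m)}` of `S` (`m = n/2`). -/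
abbrev JMod (n : ℕ) (z : ℕ → ℕ) (l : ℕ) :=
  ↥(invIdeal n z) ⧸
    Submodule.comap (invIdeal n z : Submodule (PS n) (PS n)).subtype
      (succIdeal n z l : Submodule (PS n) (PS n))

end SkewLC

set_option linter.unusedSectionVars false

namespace SkewLC

def ev {r : ℕ} (i : Fin r) : Fin (2 * r) := ⟨2 * i.1, by have := i.isLt; omega⟩
def od {r : ℕ} (i : Fin r) : Fin (2 * r) := ⟨2 * i.1 + 1, by have := i.isLt; omega⟩

lemma ev_inj {r : ℕ} {i j : Fin r} : ev i = ev j ↔ i = j := by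
  simp only [ev, Fin.ext_iff]; omega
lemma od_inj {r : ℕ} {i j : Fin r} : od i = od j ↔ i = j := by
  simp only [od, Fin.ext_iff]; omega
lemma ev_ne_od {r : ℕ} {i j : Fin r} : ev i ≠ od j := by
  simp only [od, ev, ne_eq, Fin.ext_iff]; omega
lemma od_ne_ev {r : ℕ} {i j : Fin r} : od i ≠ ev j := by
  simp only [od, ev, ne_eq, Fin.ext_iff]; omega
lemma ev_or_od {r : ℕ} (j : Fin (2 * r)) : ∃ i, j = ev i ∨ j = od i := by
  refine ⟨⟨j.1 / 2, by have := j.isLt; omega⟩, ?_⟩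
  simp only [od, ev, Fin.ext_iff]; omega

section
variable {R : Type*} [CommRing R] [Algebra ℂ R] {V : Type*} [AddCommGroup V] [Module R V]
variable (B : V →ₗ[R] V →ₗ[R] R)

def pfF (r : ℕ) (v : Fin (2 * r) → V) : R := ∏ i : Fin r, B (v (ev i)) (v (od i))

lemma pfF_update_ev {r : ℕ} (d : DecidableEq (Fin (2*r))) (v : Fin (2 * r) → V) (i : Fin r) (x : V) :
    pfF B r (Function.update v (ev i) x) =
      B x (v (od i)) * ∏ j ∈ Finset.univ.erase i, B (v (ev j)) (v (od j)) := by
  rw [pfF, ← Finset.mul_prod_erase _ _ (Finset.mem_univ i)]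
  congr 1
  · simp [Function.update_of_ne od_ne_ev]
  · refine Finset.prod_congr rfl fun j hj => ?_
    have hj := Finset.ne_of_mem_erase hj
    rw [Function.update_of_ne od_ne_ev, Function.update_of_ne (by rwa [ne_eq, ev_inj])]

lemma pfF_update_od {r : ℕ} (d : DecidableEq (Fin (2*r))) (v : Fin (2 * r) → V) (i : Fin r) (x : V) :
    pfF B r (Function.update v (od i) x) =
      B (v (ev i)) x * ∏ j ∈ Finset.univ.erase i, B (v (ev j)) (v (od j)) := by
  rw [pfF, ← Finset.mul_prod_erase _ _ (Finset.mem_univ i)]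
  congr 1
  · simp [Function.update_of_ne ev_ne_od]
  · refine Finset.prod_congr rfl fun j hj => ?_
    have hj := Finset.ne_of_mem_erase hj
    rw [Function.update_of_ne ev_ne_od, Function.update_of_ne (by rwa [ne_eq, od_inj])]

def pfM (r : ℕ) : MultilinearMap R (fun _ : Fin (2 * r) => V) R where
  toFun := pfF B r
  map_update_add' := by
    intro d v j x y
    obtain ⟨i, rfl | rfl⟩ := ev_or_od j
    · simp only [pfF_update_ev, map_add, LinearMap.add_apply, add_mul]
    · simp only [pfF_update_od, map_add, add_mul]
  map_update_smul' := by
    intro d v j c x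
    obtain ⟨i, rfl | rfl⟩ := ev_or_od j
    · simp only [pfF_update_ev, map_smul, LinearMap.smul_apply, smul_eq_mul, mul_assoc]
    · simp only [pfF_update_od, map_smul, smul_eq_mul, mul_assoc]

def cst (R : Type*) [CommRing R] [Algebra ℂ R] (r : ℕ) : R :=
  algebraMap ℂ R (((2 ^ r * r.factorial : ℕ) : ℂ))⁻¹

lemma cst_succ (s : ℕ) : cst R (s+1) * (2 * (s+1) : ℕ) = cst R s := by
  have : ((2 * (s+1) : ℕ) : R) = algebraMap ℂ R ((2 * (s+1) : ℕ) : ℂ) := (map_natCast _ _).symm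
  rw [this, cst, cst, ← map_mul]
  congr 1
  have h1 : ((s.factorial : ℕ) : ℂ) ≠ 0 := by exact_mod_cast s.factorial_ne_zero
  have h2 : ((s : ℂ) + 1) ≠ 0 := by exact_mod_cast Nat.succ_ne_zero s
  rw [Nat.factorial_succ]
  push_cast
  field_simp
  ring

def pf (r : ℕ) : V [⋀^Fin (2 * r)]→ₗ[R] R := cst R r • (pfM B r).alternatization

lemma pf_apply (r : ℕ) (v : Fin (2 * r) → V) :
    pf B r v = cst R r * ∑ σ : Equiv.Perm (Fin (2 * r)), (Equiv.Perm.sign σ : ℤ) • pfF B r (v ∘ σ) := by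
  rw [pf, AlternatingMap.smul_apply, MultilinearMap.alternatization_apply, smul_eq_mul]
  rfl

lemma pf_apply' (r : ℕ) (v : Fin (2 * r) → V) :
    pf B r v = cst R r * ∑ σ : Equiv.Perm (Fin (2 * r)), (Equiv.Perm.sign σ : ℤ) •
      ∏ i : Fin r, B (v (σ (ev i))) (v (σ (od i))) := by
  rw [pf_apply]; rfl

def cons2 {α : Type*} {s : ℕ} (x y : α) (t : Fin (2 * s) → α) : Fin (2 * (s + 1)) → α :=
  @Fin.cons (2*s+1) (fun _ => α) x (@Fin.cons (2*s) (fun _ => α) y t)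

def sh {s : ℕ} (i : Fin (2 * s)) : Fin (2 * (s + 1)) := ⟨i.1 + 2, by have := i.isLt; omega⟩
def i0 {s : ℕ} : Fin (2 * (s + 1)) := ⟨0, by omega⟩
def i1 {s : ℕ} : Fin (2 * (s + 1)) := ⟨1, by omega⟩

@[simp] lemma cons2_0 {α : Type*} {s : ℕ} (x y : α) (t : Fin (2 * s) → α) : cons2 x y t i0 = x := rfl
@[simp] lemma cons2_1 {α : Type*} {s : ℕ} (x y : α) (t : Fin (2 * s) → α) : cons2 x y t i1 = y := rfl
@[simp] lemma cons2_sh {α : Type*} {s : ℕ} (x y : α) (t : Fin (2 * s) → α) (i) : cons2 x y t (sh i) = t i := rfl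

lemma idx_cases {s : ℕ} (j : Fin (2 * (s+1))) : j = i0 ∨ j = i1 ∨ ∃ i, j = sh i := by
  rcases j with ⟨j, hj⟩
  match j, hj with
  | 0, _ => exact Or.inl rfl
  | 1, _ => exact Or.inr (Or.inl rfl)
  | j+2, hj => exact Or.inr (Or.inr ⟨⟨j, by omega⟩, rfl⟩)

lemma cons2_eta {α : Type*} {s : ℕ} (w : Fin (2 * (s + 1)) → α) :
    cons2 (w i0) (w i1) (fun i => w (sh i)) = w := by
  funext j
  rcases idx_cases j with rfl | rfl | ⟨i, rfl⟩ <;> simp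

lemma cons2_comp {α β : Type*} {s : ℕ} (g : α → β) (x y : α) (t : Fin (2 * s) → α) :
    g ∘ cons2 x y t = cons2 (g x) (g y) (g ∘ t) := by
  funext j
  rcases idx_cases j with rfl | rfl | ⟨i, rfl⟩ <;> simp

lemma sh_inj {s : ℕ} {i j : Fin (2 * s)} : sh i = sh j ↔ i = j := by
  simp [sh, Fin.ext_iff]

lemma sh_ne0 {s : ℕ} {i : Fin (2 * s)} : sh i ≠ i0 := by
  simp [sh, i0]
lemma sh_ne1 {s : ℕ} {i : Fin (2 * s)} : sh i ≠ i1 := by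
  simp [sh, i1]
lemma i0_ne1 {s : ℕ} : (i0 : Fin (2*(s+1))) ≠ i1 := by
  simp [i0, i1]

lemma cons2_upd {α : Type*} {s : ℕ} (x y : α) (t : Fin (2 * s) → α) (i z) :
    Function.update (cons2 x y t) (sh i) z = cons2 x y (Function.update t i z) := by
  funext j
  rcases idx_cases j with rfl | rfl | ⟨l, rfl⟩
  · rw [Function.update_of_ne sh_ne0.symm]; rfl
  · rw [Function.update_of_ne sh_ne1.symm]; rfl
  · simp only [Function.update_apply, sh_inj, cons2_sh]
lemma cons2_upd0 {α : Type*} {s : ℕ} (x y : α) (t : Fin (2 * s) → α) (z) :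
    Function.update (cons2 x y t) i0 z = cons2 z y t := by
  funext j
  rcases idx_cases j with rfl | rfl | ⟨l, rfl⟩
  · simp
  · rw [Function.update_of_ne i0_ne1.symm]; rfl
  · rw [Function.update_of_ne sh_ne0]; rfl
lemma cons2_upd1 {α : Type*} {s : ℕ} (x y : α) (t : Fin (2 * s) → α) (z) :
    Function.update (cons2 x y t) i1 z = cons2 x z t := by
  funext j
  rcases idx_cases j with rfl | rfl | ⟨l, rfl⟩
  · rw [Function.update_of_ne i0_ne1]; rfl
  · simp
  · rw [Function.update_of_ne sh_ne1]; rfl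

lemma pfF_succ (s : ℕ) (v : Fin (2*(s+1)) → V) :
    pfF B (s+1) v = B (v i0) (v i1) * pfF B s (fun i => v (sh i)) := by
  rw [pfF, Fin.prod_univ_succ]; rfl

variable {B} (hB : ∀ x, B x x = 0)
include hB

lemma Bskew (x y : V) : B x y = - B y x := by
  have := hB (x + y)
  simp only [map_add, LinearMap.add_apply, hB, zero_add, add_zero] at this
  linear_combination this

lemma blk_swap {r : ℕ} (i : Fin r) (v : Fin (2 * r) → V) :
    pfF B r (v ∘ Equiv.swap (ev i) (od i)) = - pfF B r v := by
  rw [pfF, pfF, ← Finset.mul_prod_erase _ _ (Finset.mem_univ i),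
    ← Finset.mul_prod_erase (a := i) _ (fun i => B (v (ev i)) (v (od i))) (Finset.mem_univ i), ← neg_mul]
  congr 1
  · simp [Bskew hB (v (od i))]
  · refine Finset.prod_congr rfl fun j hj => ?_
    have hj := Finset.ne_of_mem_erase hj
    simp only [Function.comp]
    rw [Equiv.swap_apply_of_ne_of_ne (by rwa [ne_eq, ev_inj]) ev_ne_od,
      Equiv.swap_apply_of_ne_of_ne od_ne_ev (by rwa [ne_eq, od_inj])]

omit hB in
lemma blk_swap2 {r : ℕ} (i j : Fin r) (v : Fin (2 * r) → V) :
    pfF B r (v ∘ (Equiv.swap (ev i) (ev j) * Equiv.swap (od i) (od j) : Equiv.Perm _)) = pfF B r v := by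
  rw [pfF, pfF]
  refine Fintype.prod_equiv (Equiv.swap i j) _ _ fun l => ?_
  have h1 : (Equiv.swap (ev i) (ev j) * Equiv.swap (od i) (od j) : Equiv.Perm _) (ev l) = ev (Equiv.swap i j l) := by
    rw [Equiv.Perm.mul_apply, Equiv.swap_apply_of_ne_of_ne ev_ne_od ev_ne_od]
    simp only [Equiv.swap_apply_def, ev_inj]; split_ifs <;> rfl
  have h2 : (Equiv.swap (ev i) (ev j) * Equiv.swap (od i) (od j) : Equiv.Perm _) (od l) = od (Equiv.swap i j l) := by
    rw [Equiv.Perm.mul_apply]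
    have : Equiv.swap (od i) (od j) (od l) = od (Equiv.swap i j l) := by
      simp only [Equiv.swap_apply_def, od_inj]; split_ifs <;> rfl
    rw [this, Equiv.swap_apply_of_ne_of_ne od_ne_ev od_ne_ev]
  simp only [Function.comp, h1, h2]

lemma exists_blk {s : ℕ} (p : Fin (2*(s+1))) : ∃ τ : Equiv.Perm (Fin (2*(s+1))), τ i0 = p ∧
    ∀ v : _ → V, pfF B (s+1) (v ∘ τ) = (Equiv.Perm.sign τ : ℤ) • pfF B (s+1) v := by
  have hA : ∀ i : Fin (s+1), ∃ τ : Equiv.Perm (Fin (2*(s+1))), τ i0 = ev i ∧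
    ∀ v : _ → V, pfF B (s+1) (v ∘ τ) = (Equiv.Perm.sign τ : ℤ) • pfF B (s+1) v := by
    intro i
    by_cases hi : i = 0
    · subst hi
      exact ⟨1, rfl, fun v => by simp⟩
    · refine ⟨Equiv.swap (ev 0) (ev i) * Equiv.swap (od 0) (od i), ?_, fun v => ?_⟩
      · have : (i0 : Fin (2*(s+1))) = ev 0 := rfl
        rw [this, Equiv.Perm.mul_apply, Equiv.swap_apply_of_ne_of_ne ev_ne_od ev_ne_od, Equiv.swap_apply_left]
      · rw [blk_swap2, Equiv.Perm.sign_mul, Equiv.Perm.sign_swap, Equiv.Perm.sign_swap]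
        · simp
        · rw [ne_eq, od_inj]; exact fun h => hi h.symm
        · rw [ne_eq, ev_inj]; exact fun h => hi h.symm
  obtain ⟨i, rfl | rfl⟩ := ev_or_od p
  · exact hA i
  · obtain ⟨τ, h1, h2⟩ := hA i
    refine ⟨Equiv.swap (ev i) (od i) * τ, by rw [Equiv.Perm.mul_apply, h1, Equiv.swap_apply_left], fun v => ?_⟩
    have : v ∘ (Equiv.swap (ev i) (od i) * τ : Equiv.Perm _) = (v ∘ Equiv.swap (ev i) (od i)) ∘ τ := rfl
    rw [this, h2, blk_swap hB, Equiv.Perm.sign_mul, Equiv.Perm.sign_swap ev_ne_od]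
    simp

lemma sum_perm_eq {s : ℕ} (w : Fin (2*(s+1)) → V) :
    ∑ σ : Equiv.Perm (Fin (2 * (s+1))), (Equiv.Perm.sign σ : ℤ) • pfF B (s+1) (w ∘ σ) =
    (2 * (s+1) : ℕ) * ∑ σ : Equiv.Perm (Fin (2 * (s+1))) with σ i0 = i0, (Equiv.Perm.sign σ : ℤ) • pfF B (s+1) (w ∘ σ) := by
  rw [← Finset.sum_fiberwise (s := Finset.univ) (g := fun σ : Equiv.Perm (Fin (2 * (s+1))) => σ.symm i0)]
  rw [Finset.sum_congr rfl (g := fun _ => ∑ σ : Equiv.Perm (Fin (2 * (s+1))) with σ i0 = i0, (Equiv.Perm.sign σ : ℤ) • pfF B (s+1) (w ∘ σ))]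
  · simp
  intro p _
  obtain ⟨τ, h1, h2⟩ := exists_blk hB p
  refine Finset.sum_bij' (fun σ _ => σ * τ) (fun σ _ => σ * τ⁻¹) ?_ ?_ ?_ ?_ ?_
  · intro σ h
    simp only [Finset.mem_filter, Finset.mem_univ, true_and] at h ⊢
    rw [Equiv.Perm.mul_apply, h1, ← h]; simp
  · intro σ h
    simp only [Finset.mem_filter, Finset.mem_univ, true_and] at h ⊢
    rw [Equiv.symm_apply_eq, Equiv.Perm.mul_apply, ← h1]; simp [h]
  · intro σ _; simp
  · intro σ _; simp
  · intro σ _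
    have : w ∘ (σ * τ : Equiv.Perm _) = (w ∘ σ) ∘ τ := rfl
    rw [this, h2, Equiv.Perm.sign_mul, smul_smul]
    congr 1
    rcases Int.units_eq_one_or (Equiv.Perm.sign τ) with h | h <;> simp [h]

omit hB in
lemma decomp_sum {N : ℕ} (F : Equiv.Perm (Fin (N+1)) → R) :
    ∑ σ, F σ = ∑ l : Fin (N+1), ∑ e : Equiv.Perm (Fin N), F (Equiv.Perm.decomposeFin.symm (l, e)) := by
  rw [← Fintype.sum_prod_type']
  exact Fintype.sum_equiv Equiv.Perm.decomposeFin _ _ (fun σ => by simp)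

omit hB in
lemma sum_fix {N : ℕ} (F : Equiv.Perm (Fin (N+1)) → R) :
    ∑ σ : Equiv.Perm (Fin (N+1)) with σ 0 = 0, F σ =
      ∑ e : Equiv.Perm (Fin N), F (Equiv.Perm.decomposeFin.symm (0, e)) := by
  rw [Finset.sum_filter, decomp_sum, Finset.sum_eq_single 0]
  · simp
  · intro b _ hb; simp [hb]
  · simp

lemma pf_expand {s : ℕ} (x y : V) (t : Fin (2 * s) → V) :
    pf B (s+1) (cons2 x y t) = B x y * pf B s t - ∑ l, B x (t l) * pf B s (Function.update t l y) := by
  rw [pf_apply, sum_perm_eq hB, ← mul_assoc, cst_succ]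
  have key : ∑ σ : Equiv.Perm (Fin (2 * (s+1))) with σ i0 = i0, (Equiv.Perm.sign σ : ℤ) • pfF B (s+1) (cons2 x y t ∘ σ)
    = B x y * ∑ e : Equiv.Perm (Fin (2 * s)), (Equiv.Perm.sign e : ℤ) • pfF B s (t ∘ e)
      - ∑ l, B x (t l) * ∑ e : Equiv.Perm (Fin (2 * s)), (Equiv.Perm.sign e : ℤ) • pfF B s (Function.update t l y ∘ e) := by
    refine (sum_fix (N := 2 * s + 1) (fun σ => (Equiv.Perm.sign σ : ℤ) • pfF B (s+1) (cons2 x y t ∘ σ))).trans ?_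
    rw [decomp_sum, Fin.sum_univ_succ, sub_eq_add_neg, ← Finset.sum_neg_distrib]
    congr 1
    · rw [Finset.mul_sum]
      refine Finset.sum_congr rfl fun e _ => ?_
      rw [pfF_succ, mul_smul_comm]
      congr 1
      · have hs : (Equiv.Perm.sign (Equiv.Perm.decomposeFin.symm ((0 : Fin (2*s+1+1)), Equiv.Perm.decomposeFin.symm ((0 : Fin (2*s+1)), e))) : ℤ) = (Equiv.Perm.sign e : ℤ) := by
          rw [Equiv.Perm.decomposeFin.symm_sign, Equiv.Perm.decomposeFin.symm_sign]
          simp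
        exact hs
    · refine Finset.sum_congr rfl fun l _ => ?_
      rw [Finset.mul_sum, ← Finset.sum_neg_distrib]
      refine Finset.sum_congr rfl fun e _ => ?_
      rw [pfF_succ]
      have hs : (Equiv.Perm.sign (Equiv.Perm.decomposeFin.symm ((0 : Fin (2*s+1+1)), Equiv.Perm.decomposeFin.symm (l.succ, e))) : ℤ) = - (Equiv.Perm.sign e : ℤ) := by
        rw [Equiv.Perm.decomposeFin.symm_sign, Equiv.Perm.decomposeFin.symm_sign]
        simp [Fin.succ_ne_zero]
      have h0 : (Equiv.Perm.decomposeFin.symm ((0 : Fin (2*s+1+1)), Equiv.Perm.decomposeFin.symm (l.succ, e))) i0 = i0 := 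
        Equiv.Perm.decomposeFin_symm_apply_zero _ _
      have h1 : (Equiv.Perm.decomposeFin.symm ((0 : Fin (2*s+1+1)), Equiv.Perm.decomposeFin.symm (l.succ, e))) i1 = sh l := by
        refine (Equiv.Perm.decomposeFin_symm_apply_succ _ _ (0 : Fin (2*s+1))).trans ?_
        rw [Equiv.Perm.decomposeFin_symm_apply_zero]
        simp; rfl
      have h2 : ∀ i, cons2 x y t ((Equiv.Perm.decomposeFin.symm ((0 : Fin (2*s+1+1)), Equiv.Perm.decomposeFin.symm (l.succ, e))) (sh i)) = Function.update t l y (e i) := by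
        intro i
        have : (Equiv.Perm.decomposeFin.symm ((0 : Fin (2*s+1+1)), Equiv.Perm.decomposeFin.symm (l.succ, e))) (sh i) = ((Equiv.swap 0 l.succ (e i).succ : Fin (2*s+1)).succ : Fin (2*s+1+1)) := by
          refine (Equiv.Perm.decomposeFin_symm_apply_succ _ _ (Fin.succ i)).trans ?_
          rw [Equiv.Perm.decomposeFin_symm_apply_succ]
          simp
        refine (congrArg _ this).trans ?_
        by_cases h : e i = l
        · rw [h, Function.update_self, Equiv.swap_apply_right]; rfl
        · rw [Function.update_of_ne h, Equiv.swap_apply_of_ne_of_ne (Fin.succ_ne_zero _) (by simpa using h)]; rfl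
      simp only [Function.comp]
      erw [hs, h0, h1]
      rw [cons2_0, cons2_sh, neg_smul, mul_smul_comm]
      congr 3
      congr 1
      funext i
      exact h2 i
  rw [key, mul_sub, pf_apply]
  congr 1
  · rw [mul_left_comm]
  · rw [Finset.mul_sum]
    refine Finset.sum_congr rfl fun l _ => ?_
    rw [pf_apply, mul_left_comm]

lemma pf_eq_zero {r : ℕ} (w : Fin (2*r) → V) (i) (h : ∀ j, B (w i) (w j) = 0) : pf B r w = 0 := by
  rw [pf_apply, Finset.sum_eq_zero, mul_zero]
  intro σ _
  rw [pfF]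
  obtain ⟨l, hl⟩ := ev_or_od (σ.symm i)
  rw [Finset.prod_eq_zero (Finset.mem_univ l), smul_zero]
  rcases hl with hl | hl
  · rw [Equiv.symm_apply_eq] at hl
    simp only [Function.comp, ← hl, h]
  · rw [Equiv.symm_apply_eq] at hl
    simp only [Function.comp, ← hl]
    rw [Bskew hB, h, neg_zero]

omit hB in
lemma der_pf_zero (D : Derivation ℂ R R) {r : ℕ} (w : Fin (2*r) → V) (h : ∀ i j, D (B (w i) (w j)) = 0) :
    D (pf B r w) = 0 := by
  rw [pf_apply, cst, ← Algebra.smul_def, Derivation.map_smul, map_sum, Finset.sum_eq_zero, smul_zero]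
  intro σ _
  rw [map_zsmul, pfF]
  have : ∀ T : Finset (Fin r), D (∏ i ∈ T, B ((w ∘ σ) (ev i)) ((w ∘ σ) (od i))) = 0 := by
    intro T
    induction T using Finset.induction_on with
    | empty => simp
    | insert a T ha ih => rw [Finset.prod_insert ha, D.leibniz, ih]; simp [h]
  rw [this, smul_zero]

end
end SkewLC

namespace SkewLC

section
variable {S : Type*} [CommRing S] [Algebra ℂ S]
variable {R : Type*} [CommRing R] [Algebra ℂ R] [Algebra S R] [IsScalarTower ℂ S R]

lemma poly_coeff (J : Submodule ℂ R) (f : Polynomial R)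
    (h : ∀ τ : ℂ, τ ≠ 0 → f.eval (algebraMap ℂ R τ) ∈ J) (i : ℕ) : f.coeff i ∈ J := by
  by_contra hc
  obtain ⟨φ, h1, h2⟩ := Submodule.exists_le_ker_of_notMem hc
  let g : Polynomial ℂ := ∑ j ∈ Finset.range (f.natDegree + 1), Polynomial.monomial j (φ (f.coeff j))
  have hg : Polynomial.X * g = 0 := by
    refine Polynomial.funext fun τ => ?_
    by_cases hτ : τ = 0
    · simp [hτ]
    have : φ (f.eval (algebraMap ℂ R τ)) = 0 := h2 (h τ hτ)
    rw [Polynomial.eval_eq_sum_range, map_sum] at this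
    have h3 : g.eval τ = 0 := by
      rw [← this, Polynomial.eval_finsetSum]
      refine Finset.sum_congr rfl fun j _ => ?_
      rw [Polynomial.eval_monomial, ← map_pow, mul_comm (f.coeff j), ← Algebra.smul_def, map_smul, smul_eq_mul, mul_comm]
    simp [h3]
  have hg0 : g = 0 := by
    rcases mul_eq_zero.mp hg with h | h
    · exact absurd h Polynomial.X_ne_zero
    · exact h
  have : g.coeff i = φ (f.coeff i) := by
    simp only [g, Polynomial.finsetSum_coeff, Polynomial.coeff_monomial]
    rw [Finset.sum_ite_eq']
    split_ifs with hi
    · rfl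
    · rw [Polynomial.coeff_eq_zero_of_natDegree_lt, map_zero]
      simp only [Finset.mem_range] at hi; omega
  rw [hg0, Polynomial.coeff_zero] at this
  exact h1 this.symm

lemma poly_eval (J : Submodule S R) (f : Polynomial R)
    (h : ∀ τ : ℂ, τ ≠ 0 → f.eval (algebraMap ℂ R τ) ∈ J) (c : S) : f.eval (algebraMap S R c) ∈ J := by
  rw [Polynomial.eval_eq_sum_range]
  refine Submodule.sum_mem _ fun j _ => ?_
  rw [← map_pow, mul_comm, ← Algebra.smul_def]
  exact J.smul_mem _ (poly_coeff (J.restrictScalars ℂ) f h j)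

lemma pol_lin (J : Submodule S R) (a0 a1 b0 b1 : R) (e : ℕ)
    (h : ∀ τ : ℂ, (a0 + algebraMap ℂ R τ * a1) * (b0 + algebraMap ℂ R τ * b1) ^ e ∈ J) :
    a1 * b0 ^ e + e * a0 * b0 ^ (e - 1) * b1 ∈ J := by
  have := poly_coeff (J.restrictScalars ℂ)
    ((Polynomial.C a0 + Polynomial.C a1 * Polynomial.X) * (Polynomial.C b0 + Polynomial.C b1 * Polynomial.X) ^ e)
    (fun τ _ => by simpa [mul_comm (algebraMap ℂ R τ)] using h τ) 1
  have h2 := Polynomial.coeff_derivative ((Polynomial.C a0 + Polynomial.C a1 * Polynomial.X) * (Polynomial.C b0 + Polynomial.C b1 * Polynomial.X) ^ e) 0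
  rw [Polynomial.coeff_zero_eq_eval_zero] at h2
  simp [Polynomial.derivative_pow] at h2
  rw [← h2, Submodule.restrictScalars_mem] at this
  convert this using 1
  ring

lemma C_smul_mem (J : Submodule S R) {x : R} (h : x ∈ J) (c : ℂ) : algebraMap ℂ R c * x ∈ J := by
  rw [← Algebra.smul_def]; exact (J.restrictScalars ℂ).smul_mem c h

lemma nat_cancel (J : Submodule S R) {x : R} (N : ℕ) (hN : N ≠ 0) (h : (N : R) * x ∈ J) : x ∈ J := by
  have := C_smul_mem J h ((N : ℂ)⁻¹)
  rwa [← map_natCast (algebraMap ℂ R) N, ← mul_assoc, ← map_mul,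
    inv_mul_cancel₀ (by exact_mod_cast hN), map_one, one_mul] at this

variable {V : Type*} [AddCommGroup V] [Module R V]

structure FrSys (S : Type*) [CommRing S] [Algebra S R] (B : V →ₗ[R] V →ₗ[R] R) {n : ℕ} (Fr : (Fin n → V) → Prop) : Prop where
  alt : ∀ x, B x x = 0
  add : ∀ f, Fr f → ∀ i l, i ≠ l → ∀ τ : ℂ, Fr (Function.update f i (f i + algebraMap ℂ R τ • f l))
  perm : ∀ f, Fr f → ∀ π : Equiv.Perm (Fin n), Fr (f ∘ π)
  int : ∀ f, Fr f → ∀ i j, ∃ s : S, algebraMap S R s = B (f i) (f j)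

variable {B : V →ₗ[R] V →ₗ[R] R} {n : ℕ} {Fr : (Fin n → V) → Prop} (H : FrSys S B Fr)
include H

lemma int_mul_mem (J : Submodule S R) {f} (hf : Fr f) (i j : Fin n) {x : R} (hx : x ∈ J) : B (f i) (f j) * x ∈ J := by
  obtain ⟨s, hs⟩ := H.int f hf i j
  rw [← hs, ← Algebra.smul_def]; exact J.smul_mem _ hx

lemma A_aux {r e : ℕ} (J : Submodule S R) (ν : Fin (2*r) → Fin n) (hν : Function.Injective ν)
    (y : Fin n) (hy : ∀ l, ν l ≠ y) (hJ : ∀ f, Fr f → pf B r (f ∘ ν) ^ e ∈ J) (c : Fin (2*r) → S) (F : Finset (Fin (2*r))) :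
    ∀ f, Fr f → (pf B r (f ∘ ν) + ∑ l ∈ F, algebraMap S R (c l) * pf B r (Function.update (f ∘ ν) l (f y))) ^ e ∈ J := by
  induction F using Finset.induction_on with
  | empty => simpa using hJ
  | insert l0 F hl ih =>
    intro f hf
    rw [Finset.sum_insert hl]
    set A := pf B r (f ∘ ν)
    set Z := ∑ l ∈ F, algebraMap S R (c l) * pf B r (Function.update (f ∘ ν) l (f y)) with hZ
    set a := pf B r (Function.update (f ∘ ν) l0 (f y))
    have := poly_eval J ((Polynomial.C (A + Z) + Polynomial.X * Polynomial.C a) ^ e) (fun τ _ => by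
      have := ih _ (H.add f hf (ν l0) y (hy l0) τ)
      have h1 : Function.update f (ν l0) (f (ν l0) + algebraMap ℂ R τ • f y) y = f y :=
        Function.update_of_ne (hy l0).symm _ _
      rw [Function.update_comp_eq_of_injective f hν, h1] at this
      have h2 : pf B r (Function.update (f ∘ ν) l0 (f (ν l0) + algebraMap ℂ R τ • f y)) = A + algebraMap ℂ R τ * a := by
        rw [AlternatingMap.map_update_add, AlternatingMap.map_update_smul]
        have : Function.update (f ∘ ν) l0 (f (ν l0)) = f ∘ ν := Function.update_eq_self l0 (f ∘ ν)
        rw [this]; rfl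
      have h3 : ∑ l ∈ F, algebraMap S R (c l) * pf B r (Function.update (Function.update (f ∘ ν) l0 (f (ν l0) + algebraMap ℂ R τ • f y)) l (f y)) = Z := by
        refine Finset.sum_congr rfl fun l hlF => ?_
        have hne : l ≠ l0 := fun h => hl (h ▸ hlF)
        rw [Function.update_comm hne.symm, AlternatingMap.map_update_add, AlternatingMap.map_update_smul,
          (pf B r).map_eq_zero_of_eq (Function.update (Function.update (f ∘ ν) l (f y)) l0 (f y)) (i := l) (j := l0) _ hne]
        · rw [smul_zero, add_zero]
          congr 2
          rw [Function.update_eq_self_iff, Function.update_of_ne hne.symm]; rfl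
        · rw [Function.update_self, Function.update_of_ne hne, Function.update_self]
      rw [h2, h3] at this
      simp only [Polynomial.eval_pow, Polynomial.eval_add, Polynomial.eval_C, Polynomial.eval_mul, Polynomial.eval_X]
      convert this using 2
      ring) (c l0)
    simp only [Polynomial.eval_pow, Polynomial.eval_add, Polynomial.eval_C, Polynomial.eval_mul, Polynomial.eval_X] at this
    convert this using 2
    ring

lemma A_main {r e : ℕ} (J : Submodule S R) (ν : Fin (2*(r+1)) → Fin n) (hν : Function.Injective ν)
    (hJ : ∀ f, Fr f → pf B r (f ∘ fun i => ν (sh i)) ^ e ∈ J) (f) (hf : Fr f) : pf B (r+1) (f ∘ ν) ^ e ∈ J := by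
  have hν' : Function.Injective fun i => ν (sh i) := fun i j h => sh_inj.mp (hν h)
  have hy : ∀ l, (fun i => ν (sh i)) l ≠ ν i1 := fun l h => sh_ne1 (hν h)
  choose c hc using fun l => H.int f hf (ν i0) (ν (sh l))
  obtain ⟨sy, hsy⟩ := H.int f hf (ν i0) (ν i1)
  set t : Fin (2*r) → Fin n := fun i => ν (sh i) with ht
  set A := pf B r (f ∘ t)
  set Z := ∑ l, algebraMap S R (c l) * pf B r (Function.update (f ∘ t) l (f (ν i1)))
  have h1 : ∀ τ : ℂ, (A + algebraMap ℂ R τ * Z) ^ e ∈ J := by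
    intro τ
    have := A_aux H J t hν' (ν i1) hy hJ (fun l => algebraMap ℂ S τ * c l) Finset.univ f hf
    convert this using 3
    rw [Finset.mul_sum]
    refine Finset.sum_congr rfl fun l _ => ?_
    rw [map_mul, ← IsScalarTower.algebraMap_apply, mul_assoc]
  have h2 := poly_eval J ((Polynomial.X * Polynomial.C A - Polynomial.C Z) ^ e) (fun τ hτ => by
    have := C_smul_mem J (h1 (-τ⁻¹)) (τ ^ e)
    simp only [Polynomial.eval_pow, Polynomial.eval_sub, Polynomial.eval_C, Polynomial.eval_mul, Polynomial.eval_X]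
    rw [map_pow, ← mul_pow] at this
    convert this using 2
    have h3 : algebraMap ℂ R τ * algebraMap ℂ R (-τ⁻¹) = -1 := by
      rw [← map_mul]; simp [hτ]
    linear_combination (-Z) * h3) sy
  simp only [Polynomial.eval_pow, Polynomial.eval_sub, Polynomial.eval_C, Polynomial.eval_mul, Polynomial.eval_X] at h2
  convert h2 using 2
  rw [← cons2_eta (f ∘ ν), pf_expand H.alt]
  congr 1
  · rw [hsy]; rfl
  · refine Finset.sum_congr rfl fun l _ => ?_
    rw [hc]; rfl

end
end SkewLC

namespace SkewLC

section
variable {S : Type*} [CommRing S] [Algebra ℂ S]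
variable {R : Type*} [CommRing R] [Algebra ℂ R] [Algebra S R] [IsScalarTower ℂ S R]
variable {V : Type*} [AddCommGroup V] [Module R V]
variable {B : V →ₗ[R] V →ₗ[R] R} {n : ℕ} {Fr : (Fin n → V) → Prop}

lemma sign_mem (J : Submodule S R) (u : ℤˣ) {x : R} : u • x ∈ J ↔ x ∈ J := by
  rcases Int.units_eq_one_or u with rfl | rfl <;> simp

lemma sign_mul_mem (J : Submodule S R) (u : ℤˣ) {x y : R} : (u • x) * y ∈ J ↔ x * y ∈ J := by
  rw [smul_mul_assoc, sign_mem]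

lemma exists_not_mem {p q : ℕ} (ν : Fin p → Fin n) (hν : Function.Injective ν) (lam : Fin q → Fin n)
    (h : q < p) : ∃ l, ν l ∉ Set.range lam := by
  by_contra hc
  push Not at hc
  choose g hg using hc
  have : Function.Injective g := fun a b hab => hν (by rw [← hg, ← hg, hab])
  have := Fintype.card_le_of_injective g this
  simp at this; omega

lemma exists_not_mem' {p q : ℕ} (ν : Fin p → Fin n) (hν : Function.Injective ν) (lam : Fin q → Fin n)
    (h : q ≤ p) (a : Fin q) (ha : lam a ∉ Set.range ν) : ∃ l, ν l ∉ Set.range lam := by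
  by_contra hc
  push Not at hc
  choose g hg using hc
  have hg2 : Function.Injective g := fun a b hab => hν (by rw [← hg, ← hg, hab])
  have h3 := Fintype.card_le_of_injective g hg2
  simp at h3
  obtain rfl : p = q := by omega
  obtain ⟨b, rfl⟩ := (Finite.injective_iff_surjective.mp hg2) a
  exact ha ⟨b, (hg b).symm⟩

/-- two maps with nested ranges and same domain size -/
lemma exists_perm_of_range {p : ℕ} (ν lam : Fin p → Fin n) (hl : Function.Injective lam)
    (h : ∀ a, lam a ∈ Set.range ν) : ∃ π : Equiv.Perm (Fin p), ν ∘ π = lam := by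
  choose g hg using h
  have hg2 : Function.Injective g := fun a b hab => hl (by rw [← hg, ← hg, hab])
  exact ⟨Equiv.ofBijective g (Finite.injective_iff_bijective.mp hg2), funext hg⟩

lemma pf_update_add_smul {r : ℕ} (v : Fin (2*r) → V) (i) (c : R) (x : V) :
    pf B r (Function.update v i (v i + c • x)) = pf B r v + c * pf B r (Function.update v i x) := by
  rw [AlternatingMap.map_update_add, AlternatingMap.map_update_smul, Function.update_eq_self]; rfl

variable (H : FrSys S B Fr)
include H

lemma comp_perm_mem {s : ℕ} (J : Submodule S R) (f : Fin n → V) (ν : Fin (2*s) → Fin n) (π : Equiv.Perm (Fin (2*s))) (q : R)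
   (h : pf B s (f ∘ (ν ∘ π)) * q ∈ J) : pf B s (f ∘ ν) * q ∈ J := by
  rw [← Function.comp_assoc, AlternatingMap.map_perm] at h
  exact (sign_mul_mem J _).mp h

def PP (B : V →ₗ[R] V →ₗ[R] R) (Fr : (Fin n → V) → Prop) (J : Submodule S R) (e : ℕ) {r : ℕ} (lam : Fin (2*r) → Fin n) (s : ℕ) : Prop :=
  ∀ f, Fr f → ∀ ν : Fin (2*s) → Fin n, Function.Injective ν → (∀ a, lam a ∈ Set.range ν) →
    pf B s (f ∘ ν) * pf B r (f ∘ lam) ^ e ∈ J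

omit H in
lemma PP_base {r e : ℕ} (J : Submodule S R) (lam : Fin (2*r) → Fin n) (hl : Function.Injective lam)
    (hJ : ∀ f, Fr f → pf B r (f ∘ lam) ^ (e+1) ∈ J) : PP B Fr J e lam r := by
  intro f hf ν hν h
  obtain ⟨π, hπ⟩ := exists_perm_of_range ν lam hl h
  have := hJ f hf
  have h2 : pf B r (f ∘ lam) = Equiv.Perm.sign π • pf B r (f ∘ ν) := by
    rw [← hπ, ← Function.comp_assoc, AlternatingMap.map_perm]
  rw [pow_succ'] at this
  nth_rw 1 [h2] at this
  exact (sign_mul_mem J _).mp this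

lemma PP_one {r e s : ℕ} (J : Submodule S R) (lam : Fin (2*r) → Fin n) (hl : Function.Injective lam) (hrs : r ≤ s)
    (hP : PP B Fr J e lam s) (f) (hf : Fr f) (ν : Fin (2*s) → Fin n) (hν : Function.Injective ν) (z : Fin n)
    (hz : ∀ a, lam a ≠ z → lam a ∈ Set.range ν) : pf B s (f ∘ ν) * pf B r (f ∘ lam) ^ e ∈ J := by
  by_cases hall : ∀ a, lam a ∈ Set.range ν
  · exact hP f hf ν hν hall
  push Not at hall
  obtain ⟨a0, ha0⟩ := hall
  obtain rfl : lam a0 = z := by by_contra h; exact ha0 (hz a0 h)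
  obtain ⟨l, hlr⟩ := exists_not_mem' ν hν lam (by omega) a0 ha0
  set y := ν l with hy
  set i := lam a0 with hi
  set t : Fin (2*s) → Fin n := Function.update ν l i with ht
  have htl : t l = i := by simp [ht]
  have htne : ∀ l', l' ≠ l → t l' = ν l' := fun l' h => by simp [ht, h]
  have hiν : ∀ b, ν b ≠ i := fun b hb => ha0 ⟨b, hb⟩
  have htinj : Function.Injective t := by
    intro b c hbc
    by_cases hb : b = l <;> by_cases hc : c = l
    · rw [hb, hc]
    · rw [hb, htl, htne c hc] at hbc; exact absurd hbc.symm (hiν c)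
    · rw [hc, htl, htne b hb] at hbc; exact absurd hbc (hiν b)
    · rw [htne b hb, htne c hc] at hbc; exact hν hbc
  have hty : ∀ b, t b ≠ y := by
    intro b hb
    by_cases hbl : b = l
    · rw [hbl, htl] at hb; exact hiν l hb.symm
    · rw [htne b hbl] at hb; exact hbl (hν hb)
  have hyi : i ≠ y := htl ▸ hty l
  have htr : ∀ a, lam a ∈ Set.range t := by
    intro a
    by_cases ha : lam a = i
    · exact ⟨l, by rw [htl, ha]⟩
    · obtain ⟨b, hb⟩ := hz a ha
      refine ⟨b, ?_⟩
      rw [htne b, hb]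
      rintro rfl
      exact hlr ⟨a, hb.symm⟩
  have hlt : ∀ l', l' ≠ l → t l' ∈ Set.range lam → ∃ b, b ≠ a0 ∧ lam b = t l' := by
    rintro l' hl' ⟨b, hb⟩
    refine ⟨b, ?_, hb⟩
    rintro rfl
    exact hl' (htinj (by rw [htl, ← hb]))
  set A := pf B s (f ∘ t) with hA
  set a : Fin (2*s) → R := fun l' => pf B s (Function.update (f ∘ t) l' (f y)) with ha
  set p := pf B r (f ∘ lam) with hp
  set P : V → R := fun v => pf B r (Function.update (f ∘ lam) a0 v) with hPdef
  have hal : a l = pf B s (f ∘ ν) := by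
    simp only [ha]; congr 1
    rw [← Function.comp_update, ht, Function.update_idem, hy, Function.update_eq_self]
  have hPi : P (f i) = p := by
    simp only [hPdef, hp, hi]
    congr 1
    exact Function.update_eq_self a0 (f ∘ lam)
  -- polarization of p
  have hpol : ∀ (x : V) (τ : ℂ), pf B r (Function.update f i (f i + algebraMap ℂ R τ • x) ∘ lam) = p + algebraMap ℂ R τ * P x := by
    intro x τ
    rw [hi, Function.update_comp_eq_of_injective f hl]
    exact pf_update_add_smul (f ∘ lam) a0 _ x
  have h1 : a l * p ^ e + e * A * p ^ (e-1) * P (f y) ∈ J := by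
    refine pol_lin J _ _ _ _ e fun τ => ?_
    have := hP _ (H.add f hf i y hyi τ) t htinj htr
    rw [hpol] at this
    rw [← htl, Function.update_comp_eq_of_injective f htinj] at this
    have h2 := pf_update_add_smul (B := B) (f ∘ t) l (algebraMap ℂ R τ) (f y)
    rw [Function.comp_apply] at h2
    rw [h2] at this
    exact this
  have h2 : ∀ l', l' ≠ l → t l' ∉ Set.range lam → - a l * p ^ e + e * a l' * p ^ (e-1) * P (f (t l')) ∈ J := by
    intro l' hl' hlr'
    refine pol_lin J _ _ _ _ e fun τ => ?_
    have hit : i ≠ t l' := by rw [← htl]; exact fun h => hl' (htinj h).symm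
    set t' := Function.update t l' y with ht'
    have htl' : t' l = i := by rw [ht', Function.update_of_ne hl'.symm, htl]
    have htinj' : Function.Injective t' := by
      intro b c hbc
      by_cases hb : b = l' <;> by_cases hc : c = l'
      · rw [hb, hc]
      · rw [hb, ht', Function.update_self, Function.update_of_ne hc] at hbc; exact absurd hbc.symm (hty c)
      · rw [hc, ht', Function.update_self, Function.update_of_ne hb] at hbc; exact absurd hbc (hty b)
      · rw [ht', Function.update_of_ne hb, Function.update_of_ne hc] at hbc; exact htinj hbc
    have htr' : ∀ a, lam a ∈ Set.range t' := by
      intro a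
      obtain ⟨b, hb⟩ := htr a
      refine ⟨b, ?_⟩
      rw [ht', Function.update_of_ne, hb]
      rintro rfl
      exact hlr' ⟨a, hb.symm⟩
    have := hP _ (H.add f hf i (t l') hit τ) t' htinj' htr'
    rw [hpol] at this
    rw [← htl', Function.update_comp_eq_of_injective f htinj'] at this
    have h2 := pf_update_add_smul (B := B) (f ∘ t') l (algebraMap ℂ R τ) (f (t l'))
    rw [Function.comp_apply] at h2
    rw [h2] at this
    have e1 : f ∘ t' = Function.update (f ∘ t) l' (f y) := Function.comp_update ..
    have e2 : pf B s (Function.update (f ∘ t') l (f (t l'))) = - a l := by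
      have : Function.update (f ∘ t') l (f (t l')) = Function.update (f ∘ t) l (f y) ∘ Equiv.swap l l' := by
        rw [e1]
        funext b
        simp only [Function.comp]
        by_cases hb : b = l
        · rw [hb, Function.update_self, Equiv.swap_apply_left, Function.update_of_ne hl']; rfl
        · rw [Function.update_of_ne hb]
          by_cases hb' : b = l'
          · rw [hb', Function.update_self, Equiv.swap_apply_right, Function.update_self]
          · rw [Function.update_of_ne hb', Equiv.swap_apply_of_ne_of_ne hb hb', Function.update_of_ne hb]
      rw [this, AlternatingMap.map_swap _ _ hl'.symm]
    rw [e2, e1] at this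
    exact this
  classical
  set K : Finset (Fin (2*s)) := Finset.univ.filter fun l' => l' ≠ l ∧ t l' ∉ Set.range lam with hK
  have h3 := J.sub_mem h1 (J.sum_mem (t := K) (f := fun l' => - a l * p ^ e + e * a l' * p ^ (e-1) * P (f (t l'))) (fun l' hl' => by
    simp only [hK, Finset.mem_filter, Finset.mem_univ, true_and] at hl'
    exact h2 l' hl'.1 hl'.2))
  -- vanishing
  set v : V := A • f y - ∑ l', a l' • f (t l') with hv
  have hBv : ∀ b, B (f (t b)) v = 0 := by
    intro b
    have h4 : pf B (s+1) (cons2 (f (t b)) (f y) (f ∘ t)) = 0 :=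
      (pf B (s+1)).map_eq_zero_of_eq _ (i := i0) (j := sh b) (by simp) sh_ne0.symm
    rw [pf_expand H.alt] at h4
    rw [hv, map_sub, map_sum, map_smul, smul_eq_mul, ← h4, mul_comm]
    congr 1
    refine Finset.sum_congr rfl fun l' _ => ?_
    rw [map_smul, smul_eq_mul, mul_comm]; rfl
  have hPv : P v = 0 := by
    refine pf_eq_zero H.alt _ a0 fun j => ?_
    rw [Function.update_self]
    by_cases hj : j = a0
    · rw [hj, Function.update_self, H.alt]
    · rw [Function.update_of_ne hj, Bskew H.alt]
      obtain ⟨b, hb⟩ := htr j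
      simp only [Function.comp, ← hb, hBv, neg_zero]
  have hPlin : P v = A * P (f y) - ∑ l', a l' * P (f (t l')) := by
    have : P = ((pf B r).toMultilinearMap.toLinearMap (f ∘ lam) a0 : V → R) := rfl
    rw [this, hv, map_sub, map_sum, map_smul, smul_eq_mul]
    congr 1
    exact Finset.sum_congr rfl fun l' _ => by rw [map_smul, smul_eq_mul]
  have hsum : ∑ l', a l' * P (f (t l')) = a l * p + ∑ l' ∈ K, a l' * P (f (t l')) := by
    rw [← Finset.add_sum_erase _ _ (Finset.mem_univ l), htl, hPi]
    congr 1
    symm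
    refine Finset.sum_subset (fun l' hl' => by
      simp only [hK, Finset.mem_filter, Finset.mem_univ, true_and] at hl'
      simp [hl'.1]) fun l' hl' hlK => ?_
    have hne := Finset.ne_of_mem_erase hl'
    simp only [hK, Finset.mem_filter, Finset.mem_univ, true_and, not_and, not_not] at hlK
    obtain ⟨b, hb, hb2⟩ := hlt l' hne (hlK hne)
    rw [← hb2]
    have : P (f (lam b)) = 0 := by
      refine (pf B r).map_eq_zero_of_eq _ (i := b) (j := a0) ?_ hb
      rw [Function.update_of_ne hb, Function.update_self]; rfl
    rw [this, mul_zero]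
  have hkey : A * P (f y) - ∑ l' ∈ K, a l' * P (f (t l')) = a l * p := by
    rw [hPv] at hPlin
    linear_combination (-1 : R) * hPlin + hsum
  refine nat_cancel J (1 + K.card + e) (by omega) ?_
  convert h3 using 1
  rw [← hal, Finset.sum_add_distrib, Finset.sum_const, nsmul_eq_mul]
  have h5 : ∑ l' ∈ K, (e : R) * a l' * p ^ (e-1) * P (f (t l')) = e * p ^ (e-1) * ∑ l' ∈ K, a l' * P (f (t l')) := by
    rw [Finset.mul_sum]
    exact Finset.sum_congr rfl fun l' _ => by ring
  rw [h5]
  have h6 : (e : R) * p ^ e = e * p ^ (e-1) * p := by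
    cases e with
    | zero => simp
    | succ e => simp [pow_succ, mul_assoc]
  push_cast
  linear_combination (-(e : R)) * p ^ (e-1) * hkey + a l * h6

lemma PP_succ {r e s : ℕ} (J : Submodule S R) (lam : Fin (2*r) → Fin n) (hl : Function.Injective lam) (hrs : r ≤ s)
    (hP : PP B Fr J e lam s) : PP B Fr J e lam (s+1) := by
  intro f hf ν hν hr
  obtain ⟨c, hc⟩ := exists_not_mem ν hν lam (by omega)
  refine comp_perm_mem H J f ν (Equiv.swap i0 c) _ ?_
  set ν' := ν ∘ Equiv.swap i0 c with hν'
  have hinj : Function.Injective ν' := hν.comp (Equiv.injective _)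
  have h0 : ν' i0 ∉ Set.range lam := by simpa [hν'] using hc
  have hr' : ∀ a, lam a ∈ Set.range ν' := by
    intro a
    rw [hν', (Equiv.surjective _).range_comp]; exact hr a
  rw [← cons2_eta (f ∘ ν'), pf_expand H.alt, sub_mul, Finset.sum_mul]
  refine J.sub_mem ?_ (J.sum_mem fun l _ => ?_)
  · rw [mul_assoc]
    refine int_mul_mem H J hf _ _ (PP_one H J lam hl hrs hP f hf (fun i => ν' (sh i)) ?_ (ν' i1) ?_)
    · exact fun i j h => sh_inj.mp (hinj h)
    · intro a ha
      obtain ⟨b, hb⟩ := hr' a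
      rcases idx_cases b with rfl | rfl | ⟨i, rfl⟩
      · exact absurd ⟨a, hb.symm⟩ h0
      · exact absurd hb.symm ha
      · exact ⟨i, hb⟩
  · rw [mul_assoc]
    refine int_mul_mem H J hf _ _ ?_
    have := PP_one H J lam hl hrs hP f hf (Function.update (fun i => ν' (sh i)) l (ν' i1)) ?_ (ν' (sh l)) ?_
    · rw [Function.comp_update] at this
      exact this
    · intro b c hbc
      by_cases hb : b = l <;> by_cases hc : c = l
      · rw [hb, hc]
      · rw [hb, Function.update_self, Function.update_of_ne hc] at hbc; exact absurd (hinj hbc).symm sh_ne1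
      · rw [hc, Function.update_self, Function.update_of_ne hb] at hbc; exact absurd (hinj hbc) sh_ne1
      · rw [Function.update_of_ne hb, Function.update_of_ne hc] at hbc; exact sh_inj.mp (hinj hbc)
    · intro a ha
      obtain ⟨b, hb⟩ := hr' a
      rcases idx_cases b with rfl | rfl | ⟨i, rfl⟩
      · exact absurd ⟨a, hb.symm⟩ h0
      · exact ⟨l, by rw [Function.update_self, hb]⟩
      · refine ⟨i, ?_⟩
        rw [Function.update_of_ne, hb]
        rintro rfl
        exact ha hb.symm

lemma PP_all {r e s : ℕ} (J : Submodule S R) (lam : Fin (2*r) → Fin n) (hl : Function.Injective lam) (hrs : r ≤ s)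
    (hJ : ∀ f, Fr f → pf B r (f ∘ lam) ^ (e+1) ∈ J) : PP B Fr J e lam s := by
  induction s, hrs using Nat.le_induction with
  | base => exact PP_base J lam hl hJ
  | succ s hs ih => exact PP_succ H J lam hl hs ih

end
end SkewLC

namespace SkewLC

lemma exists_perm01 {s : ℕ} (a b : Fin (2*(s+1))) (hab : a ≠ b) :
    ∃ π : Equiv.Perm (Fin (2*(s+1))), π i0 = a ∧ π i1 = b := by
  refine ⟨Equiv.swap i0 a * Equiv.swap i1 (Equiv.swap i0 a b), ?_, ?_⟩
  · rw [Equiv.Perm.mul_apply, Equiv.swap_apply_of_ne_of_ne i0_ne1, Equiv.swap_apply_left]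
    intro h
    have := congrArg (Equiv.swap i0 a) h
    rw [Equiv.swap_apply_left, Equiv.swap_apply_self] at this
    exact hab this
  · rw [Equiv.Perm.mul_apply, Equiv.swap_apply_left, Equiv.swap_apply_self]

section
variable {R : Type*} [CommRing R] [Algebra ℂ R]
variable {V : Type*} [AddCommGroup V] [Module R V]
variable {B : V →ₗ[R] V →ₗ[R] R} {n : ℕ} 

structure Dual (B : V →ₗ[R] V →ₗ[R] R) (f : Fin n → V) (Δ : Fin n → Fin n → Derivation ℂ R R) (u : Fin n → V) (h : Fin n → Fin n → R) : Prop where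
  alt : ∀ x, B x x = 0
  der : ∀ a b i j, Δ a b (B (f i) (f j)) = (if i = a ∧ j = b then 1 else 0) - (if i = b ∧ j = a then 1 else 0)
  dual : ∀ b j, B (u b) (f j) = if b = j then 1 else 0
  lin : ∀ b, u b = ∑ i, h b i • f i

lemma exists_dual (hB : ∀ x, B x x = 0) {m : ℕ} (f : Fin (2*(m+1)) → V) (hu : IsUnit (pf B (m+1) f)) :
    ∃ (u : Fin (2*(m+1)) → V) (h : Fin (2*(m+1)) → Fin (2*(m+1)) → R),
      (∀ b j, B (u b) (f j) = if b = j then 1 else 0) ∧ (∀ b, u b = ∑ i, h b i • f i) := by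
  have : ∀ b, ∃ (u : V) (h : Fin (2*(m+1)) → R), (∀ j, B u (f j) = if b = j then 1 else 0) ∧ u = ∑ i, h i • f i := by
    intro b
    set w := f ∘ Equiv.swap i0 b with hw
    have hpw : IsUnit (pf B (m+1) w) := by
      rw [hw, AlternatingMap.map_perm]
      rcases Int.units_eq_one_or (Equiv.Perm.sign (Equiv.swap i0 b)) with h | h <;> rw [h]
      · simpa using hu
      · simpa using hu
    obtain ⟨q, hq⟩ := hpw.exists_right_inv
    set t : Fin (2*m) → V := fun i => w (sh i) with ht
    set v : V := pf B m t • w i1 - ∑ l, pf B m (Function.update t l (w i1)) • t l with hv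
    have hBv : ∀ x, B x v = pf B (m+1) (cons2 x (w i1) t) := by
      intro x
      rw [pf_expand hB, hv, map_sub, map_sum, map_smul, smul_eq_mul, mul_comm]
      congr 1
      refine Finset.sum_congr rfl fun l' _ => ?_
      rw [map_smul, smul_eq_mul, mul_comm]
    have hspan : (-q) • v ∈ Submodule.span R (Set.range f) := by
      have hwm : ∀ i, w i ∈ Submodule.span R (Set.range f) := fun i => Submodule.subset_span ⟨_, rfl⟩
      refine Submodule.smul_mem _ _ (Submodule.sub_mem _ (Submodule.smul_mem _ _ (hwm _)) (Submodule.sum_mem _ fun l _ => Submodule.smul_mem _ _ (hwm _)))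
    obtain ⟨h, hh⟩ := (Submodule.mem_span_range_iff_exists_fun R).mp hspan
    refine ⟨(-q) • v, h, fun j => ?_, hh.symm⟩
    rw [map_smul, LinearMap.smul_apply, Bskew hB, hBv, smul_eq_mul, neg_mul_neg]
    split_ifs with hbj
    · have : f j = w i0 := by simp [hw, hbj]
      rw [this, cons2_eta, mul_comm, hq]
    · obtain ⟨c, rfl⟩ : ∃ c, j = Equiv.swap i0 b c := ⟨Equiv.swap i0 b j, by simp⟩
      have hc : c ≠ i0 := by rintro rfl; simp at hbj
      rw [(pf B (m+1)).map_eq_zero_of_eq _ (i := i0) (j := c) _ hc.symm, mul_zero]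
      rcases idx_cases c with rfl | rfl | ⟨i, rfl⟩
      · exact absurd rfl hc
      · rfl
      · rfl
  choose u h h1 h2 using this
  exact ⟨u, h, h1, h2⟩

variable {f : Fin n → V} {Δ : Fin n → Fin n → Derivation ℂ R R} {u : Fin n → V} {h : Fin n → Fin n → R}
variable (D : Dual B f Δ u h)
include D

lemma h_eq (a b) : h a b = B (u b) (u a) := by
  rw [D.lin a, map_sum, Finset.sum_eq_single b]
  · rw [map_smul, D.dual, if_pos rfl, smul_eq_mul, mul_one]
  · intro c _ hc
    rw [map_smul, D.dual, if_neg hc.symm, smul_zero]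
  · simp

lemma h_skew (a b) : h a b = - h b a := by
  rw [h_eq D a, h_eq D b, Bskew D.alt]

lemma h_self (a) : h a a = 0 := by
  rw [h_eq D a, D.alt]

lemma der_zero {s : ℕ} (ν : Fin (2*s) → Fin n) (a b : Fin n) (hab : a ∉ Set.range ν ∨ b ∉ Set.range ν) :
    Δ a b (pf B s (f ∘ ν)) = 0 := by
  refine der_pf_zero _ _ fun i j => ?_
  simp only [Function.comp, D.der]
  rcases hab with ha | ha
  · have h1 : ∀ i, ν i ≠ a := fun i hi => ha ⟨i, hi⟩
    simp [h1]
  · have h1 : ∀ i, ν i ≠ b := fun i hi => ha ⟨i, hi⟩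
    simp [h1]

lemma der_self {s : ℕ} (ν : Fin (2*s) → Fin n) (a : Fin n) : Δ a a (pf B s (f ∘ ν)) = 0 := by
  refine der_pf_zero _ _ fun i j => ?_
  simp only [Function.comp, D.der, sub_self]

lemma der_cons2 {s : ℕ} (ν : Fin (2*s) → Fin n) (a b : Fin n) (hab : a ≠ b) (ha : a ∉ Set.range ν) (hb : b ∉ Set.range ν) :
    Δ a b (pf B (s+1) (cons2 (f a) (f b) (f ∘ ν))) = pf B s (f ∘ ν) := by
  rw [pf_expand D.alt, map_sub, Derivation.leibniz, der_zero D ν a b (Or.inl ha), D.der, map_sum, Finset.sum_eq_zero]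
  · simp [hab]
  · intro l _
    have hl : ν l ≠ b := fun hi => hb ⟨l, hi⟩
    have hl' : ν l ≠ a := fun hi => ha ⟨l, hi⟩
    have h2 : Δ a b (pf B s (Function.update (f ∘ ν) l (f b))) = 0 := by
      rw [← Function.comp_update]
      refine der_zero D _ a b (Or.inl ?_)
      rintro ⟨c, hc⟩
      by_cases hcl : c = l
      · rw [hcl, Function.update_self] at hc; exact hab hc.symm
      · rw [Function.update_of_ne hcl] at hc; exact ha ⟨c, hc⟩
    have h3 : Δ a b (B (f a) ((f ∘ ν) l)) = 0 := by
      simp [D.der, hl, hl']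
    rw [Derivation.leibniz, h2, h3]; simp

lemma pf_u {s : ℕ} (ν : Fin (2*s) → Fin n) (b : Fin n) (hb : b ∉ Set.range ν) :
    pf B (s+1) (cons2 (u b) (f b) (f ∘ ν)) = pf B s (f ∘ ν) := by
  rw [pf_expand D.alt, D.dual, if_pos rfl, one_mul, Finset.sum_eq_zero, sub_zero]
  intro l _
  have hl : b ≠ ν l := fun hi => hb ⟨l, hi.symm⟩
  simp [D.dual, hl]

omit D in
lemma cons2_lin {s : ℕ} (y : V) (t : Fin (2*s) → V) (c : Fin n → R) (g : Fin n → V) :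
    pf B (s+1) (cons2 (∑ i, c i • g i) y t) = ∑ i, c i * pf B (s+1) (cons2 (g i) y t) := by
  have : ∀ x, pf B (s+1) (cons2 x y t) = (pf B (s+1)).toMultilinearMap.toLinearMap (cons2 0 y t) i0 x := by
    intro x
    show _ = pf B (s+1) (Function.update (cons2 0 y t) i0 x)
    rw [cons2_upd0]
  simp only [this, map_sum, map_smul, smul_eq_mul]

omit D in
lemma cons2_swap {s : ℕ} (x y : V) (t : Fin (2*s) → V) :
    pf B (s+1) (cons2 x y t) = - pf B (s+1) (cons2 y x t) := by
  rw [← AlternatingMap.map_swap _ _ (i0_ne1 (s := s))]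
  congr 1
  funext j
  rcases idx_cases j with rfl | rfl | ⟨i, rfl⟩
  · simp
  · simp
  · simp [Equiv.swap_apply_of_ne_of_ne sh_ne0 sh_ne1]

lemma sum_h {s : ℕ} (ν : Fin (2*s) → Fin n) (b : Fin n) (hb : b ∉ Set.range ν) :
    ∑ i, h b i * pf B (s+1) (cons2 (f i) (f b) (f ∘ ν)) = pf B s (f ∘ ν) := by
  rw [← cons2_lin, ← D.lin, pf_u D ν b hb]

lemma sum_h' {s : ℕ} (ν : Fin (2*s) → Fin n) (a : Fin n) (ha : a ∉ Set.range ν) :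
    ∑ b, h b a * pf B (s+1) (cons2 (f a) (f b) (f ∘ ν)) = pf B s (f ∘ ν) := by
  rw [← sum_h D ν a ha]
  refine Finset.sum_congr rfl fun b _ => ?_
  rw [h_skew D b a, cons2_swap (f a)]; ring

omit D in
lemma pf_rep {s : ℕ} (ν : Fin (2*s) → Fin n) (a b : Fin n) (hb : b = a ∨ b ∈ Set.range ν) :
    pf B (s+1) (cons2 (f a) (f b) (f ∘ ν)) = 0 := by
  rcases hb with rfl | ⟨l, rfl⟩
  · exact (pf B (s+1)).map_eq_zero_of_eq _ (i := i0) (j := i1) rfl i0_ne1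
  · exact (pf B (s+1)).map_eq_zero_of_eq _ (i := i1) (j := sh l) rfl sh_ne1.symm

/-- full complement -/
lemma compl_h {s : ℕ} (ν : Fin (2*s) → Fin n) (a b : Fin n) (ha : a ∉ Set.range ν)
    (hc : ∀ c, c = a ∨ c = b ∨ c ∈ Set.range ν) :
    h b a * pf B (s+1) (cons2 (f a) (f b) (f ∘ ν)) = pf B s (f ∘ ν) := by
  rw [← sum_h' D ν a ha, Finset.sum_eq_single b]
  · intro c _ hcb
    rw [pf_rep, mul_zero]
    rcases hc c with h | h | h
    · exact Or.inl h
    · exact absurd h hcb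
    · exact Or.inr h
  · simp
end

section
variable {R : Type*} [CommRing R] [Algebra ℂ R]
variable {V : Type*} [AddCommGroup V] [Module R V]
variable {B : V →ₗ[R] V →ₗ[R] R} {m : ℕ} 
variable {f : Fin (2*(m+1)) → V} {Δ : Fin (2*(m+1)) → Fin (2*(m+1)) → Derivation ℂ R R} {u : Fin (2*(m+1)) → V} {h : Fin (2*(m+1)) → Fin (2*(m+1)) → R}
variable (D : Dual B f Δ u h)
include D

lemma perm_facts (π : Equiv.Perm (Fin (2*(m+1)))) : 
    (π i0 ∉ Set.range fun i => π (sh i)) ∧ (π i1 ∉ Set.range fun i => π (sh i)) ∧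
    (∀ c, c = π i0 ∨ c = π i1 ∨ c ∈ Set.range fun i => π (sh i)) := by
  refine ⟨?_, ?_, ?_⟩
  · rintro ⟨i, hi⟩; exact sh_ne0 (π.injective hi)
  · rintro ⟨i, hi⟩; exact sh_ne1 (π.injective hi)
  · intro c
    obtain ⟨d, rfl⟩ := π.surjective c
    rcases idx_cases d with rfl | rfl | ⟨i, rfl⟩
    · exact Or.inl rfl
    · exact Or.inr (Or.inl rfl)
    · exact Or.inr (Or.inr ⟨i, rfl⟩)

lemma perm_h (π : Equiv.Perm (Fin (2*(m+1)))) :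
    h (π i1) (π i0) * (Equiv.Perm.sign π • pf B (m+1) f) = pf B m (f ∘ fun i => π (sh i)) := by
  obtain ⟨h1, h2, h3⟩ := perm_facts D π
  rw [← compl_h D _ _ _ h1 h3, ← AlternatingMap.map_perm, ← cons2_eta (f ∘ π)]; rfl

lemma der_full (a b) : Δ a b (pf B (m+1) f) = h b a * pf B (m+1) f := by
  by_cases hab : a = b
  · subst hab
    rw [h_self D, zero_mul]; exact der_self D id a
  obtain ⟨π, rfl, rfl⟩ := exists_perm01 a b hab
  obtain ⟨h1, h2, h3⟩ := perm_facts D π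
  have e1 := der_cons2 D _ _ _ hab h1 h2
  rw [← perm_h D] at e1
  have e2 : cons2 (f (π i0)) (f (π i1)) (f ∘ fun i => π (sh i)) = f ∘ π := cons2_eta (f ∘ π)
  rw [e2, AlternatingMap.map_perm] at e1
  rcases Int.units_eq_one_or (Equiv.Perm.sign π) with h | h <;> rw [h] at e1 <;> simpa using e1

lemma der_Pi (Pf Pi : R) (hm : Pf * Pi = 1) (z : ℂ) (hz : z ≠ 0) (hq : pf B (m+1) f = algebraMap ℂ R z * Pf) (a b) (N : ℕ) :
    Δ a b (Pi ^ N) = - (N * h b a * Pi ^ N) := by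
  have h1 := der_full D a b
  rw [hq, ← Algebra.smul_def, Derivation.map_smul, mul_smul_comm] at h1
  have h2 : Δ a b Pf = h b a * Pf := smul_right_injective R hz h1
  have h3 : Δ a b (Pf * Pi) = 0 := by rw [hm]; exact Derivation.map_one_eq_zero _
  rw [Derivation.leibniz, h2, smul_eq_mul, smul_eq_mul] at h3
  have h4 : Δ a b Pi = - (h b a * Pi) := by
    linear_combination Pi * h3 - (Δ a b Pi + h b a * Pi) * hm
  rw [Derivation.leibniz_pow, h4]
  cases N with
  | zero => simp
  | succ N => simp [pow_succ]; ring

end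
end SkewLC

namespace SkewLC

section
variable {S : Type*} [CommRing S] [Algebra ℂ S]
variable {R : Type*} [CommRing R] [Algebra ℂ R] [Algebra S R] [IsScalarTower ℂ S R]
variable {V : Type*} [AddCommGroup V] [Module R V]
variable {B : V →ₗ[R] V →ₗ[R] R} {m : ℕ}

structure FrSys2 (S : Type*) [CommRing S] [Algebra S R] (B : V →ₗ[R] V →ₗ[R] R) {m : ℕ} (Fr : (Fin (2*(m+1)) → V) → Prop)
    (Pf Pi : R) (𝒟 : Submodule ℂ (Derivation ℂ R R)) : Prop extends FrSys S B Fr where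
  mul : Pf * Pi = 1
  det : ∀ f, Fr f → ∃ z : ℂ, z ≠ 0 ∧ pf B (m+1) f = algebraMap ℂ R z * Pf
  der : ∀ f, Fr f → ∃ Δ : Fin (2*(m+1)) → Fin (2*(m+1)) → Derivation ℂ R R,
    (∀ a b i j, Δ a b (B (f i) (f j)) = (if i = a ∧ j = b then 1 else 0) - (if i = b ∧ j = a then 1 else 0)) ∧
    (∀ a b, Δ a b ∈ 𝒟) ∧ 𝒟 ≤ Submodule.span ℂ (Set.range fun p : Fin (2*(m+1)) × Fin (2*(m+1)) => Δ p.1 p.2)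

variable {Fr : (Fin (2*(m+1)) → V) → Prop} {Pf Pi : R} {𝒟 : Submodule ℂ (Derivation ℂ R R)}
variable (H : FrSys2 S B Fr Pf Pi 𝒟)
include H

lemma get_dual (f) (hf : Fr f) : ∃ Δ u h, Dual B f Δ u h ∧ (∀ a b, Δ a b ∈ 𝒟) ∧
    𝒟 ≤ Submodule.span ℂ (Set.range fun p : Fin (2*(m+1)) × Fin (2*(m+1)) => Δ p.1 p.2) := by
  obtain ⟨Δ, h1, h2, h3⟩ := H.der f hf
  obtain ⟨z, hz, hq⟩ := H.det f hf
  have hu : IsUnit (pf B (m+1) f) := by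
    rw [hq]
    exact ((IsUnit.mk0 z hz).map _).mul (IsUnit.of_mul_eq_one _ H.mul)
  obtain ⟨u, h, h4, h5⟩ := exists_dual H.alt f hu
  exact ⟨Δ, u, h, ⟨H.alt, h1, h4, h5⟩, h2, h3⟩

lemma main_case_ii {r e k : ℕ} (J : Submodule S R) (lam : Fin (2*(r+1)) → Fin (2*(m+1))) (hl : Function.Injective lam)
    (hrk : r + 1 + k = m + 1) (hk : 1 ≤ k)
    (hJ : ∀ f, Fr f → pf B (r+1) (f ∘ lam) ^ (e+1) ∈ J)
    (f) (hf : Fr f) {Δ u h} (D : Dual B f Δ u h) (α β) (hαβ : α ≠ β) :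
    pf B (m+1) f * (e * pf B (r+1) (f ∘ lam) ^ (e-1) * Δ (lam α) (lam β) (pf B (r+1) (f ∘ lam))
      - (e + 2 * k) * h (lam β) (lam α) * pf B (r+1) (f ∘ lam) ^ e) ∈ J := by
  have hPP : PP B Fr J e lam m := PP_all H.toFrSys J lam hl (by omega) hJ
  set a := lam α with ha
  set b := lam β with hb
  have hab : a ≠ b := fun h => hαβ (hl h)
  set p := pf B (r+1) (f ∘ lam) with hp
  set q := pf B (m+1) f with hq
  set P : V → R := fun v => pf B (r+1) (Function.update (f ∘ lam) β v) with hPdef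
  have hPb : P (f b) = p := by
    simp only [hPdef, hp, hb]
    congr 1
    exact Function.update_eq_self β (f ∘ lam)
  have hpol : ∀ (x : V) (τ : ℂ), pf B (r+1) (Function.update f b (f b + algebraMap ℂ R τ • x) ∘ lam) = p + algebraMap ℂ R τ * P x := by
    intro x τ
    rw [hb, Function.update_comp_eq_of_injective f hl]
    exact pf_update_add_smul (f ∘ lam) β _ x
  have h1 : ∀ l, l ∉ Set.range lam → q * (- h b a * p ^ e + e * h l a * p ^ (e-1) * P (f l)) ∈ J := by
    intro l hlr
    have hal : a ≠ l := fun hh => hlr ⟨α, hh⟩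
    have hbl : b ≠ l := fun hh => hlr ⟨β, hh⟩
    obtain ⟨π, hπ0, hπ1⟩ := exists_perm01 a l hal
    obtain ⟨h1, h2, h3⟩ := perm_facts D π
    set ν : Fin (2*m) → Fin (2*(m+1)) := fun i => π (sh i) with hν
    rw [hπ0] at h1 h3
    rw [hπ1] at h2 h3
    have hνinj : Function.Injective ν := fun i j hh => sh_inj.mp (π.injective hh)
    obtain ⟨j, hj⟩ : b ∈ Set.range ν := by
      rcases h3 b with h | h | h
      · exact absurd h.symm hab
      · exact absurd h hbl
      · exact h
    have hA := perm_h D π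
    rw [hπ0, hπ1] at hA
    have hpol2 : pf B m (Function.update (f ∘ ν) j (f l)) * p ^ e + e * pf B m (f ∘ ν) * p ^ (e-1) * P (f l) ∈ J := by
      refine pol_lin J _ _ _ _ e fun τ => ?_
      have := PP_one H.toFrSys J lam hl (by omega) hPP _ (H.add f hf b l hbl τ) ν hνinj a (by
        intro c hc
        rcases h3 (lam c) with h | h | h
        · exact absurd h hc
        · exact absurd ⟨c, h⟩ hlr
        · exact h)
      rw [hpol] at this
      rw [← hj, Function.update_comp_eq_of_injective f hνinj] at this
      have h2 := pf_update_add_smul (B := B) (f ∘ ν) j (algebraMap ℂ R τ) (f l)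
      rw [Function.comp_apply] at h2
      rw [h2] at this
      exact this
    have hA1 : pf B m (Function.update (f ∘ ν) j (f l)) = - (h b a * (Equiv.Perm.sign π • q)) := by
      rw [← Function.comp_update, ← compl_h D (Function.update ν j l) a b]
      · rw [← mul_neg]
        congr 1
        rw [hq, ← AlternatingMap.map_perm, ← AlternatingMap.map_swap _ _ (sh_ne1 (i := j)).symm]
        congr 1
        rw [← cons2_comp, Function.comp_assoc]
        congr 1
        funext c
        rcases idx_cases c with rfl | rfl | ⟨i, rfl⟩
        · rw [cons2_0, Function.comp, Equiv.swap_apply_of_ne_of_ne i0_ne1 sh_ne0.symm, hπ0]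
        · rw [cons2_1, Function.comp, Equiv.swap_apply_left]; exact hj.symm
        · rw [cons2_sh, Function.comp]
          by_cases hij : i = j
          · rw [hij, Function.update_self, Equiv.swap_apply_right, hπ1]
          · rw [Function.update_of_ne hij, Equiv.swap_apply_of_ne_of_ne sh_ne1 (fun h => hij (sh_inj.mp h))]
      · rintro ⟨c, hc⟩
        by_cases hcj : c = j
        · rw [hcj, Function.update_self] at hc; exact hal hc.symm
        · rw [Function.update_of_ne hcj] at hc; exact h1 ⟨c, hc⟩
      · intro c
        rcases h3 c with h | h | ⟨d, h⟩
        · exact Or.inl h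
        · exact Or.inr (Or.inr ⟨j, by rw [Function.update_self, h]⟩)
        · by_cases hdj : d = j
          · exact Or.inr (Or.inl (by rw [← h, hdj, hj]))
          · exact Or.inr (Or.inr ⟨d, by rw [Function.update_of_ne hdj, h]⟩)
    rw [hA1, ← hA] at hpol2
    rw [← sign_mem J (Equiv.Perm.sign π)]
    convert hpol2 using 1
    rcases Int.units_eq_one_or (Equiv.Perm.sign π) with h | h <;> rw [h]
    · simp only [one_smul]; ring
    · simp only [Units.neg_smul, one_smul]; ring
  classical
  set K : Finset (Fin (2*(m+1))) := Finset.univ.filter fun l => l ∉ Set.range lam with hK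
  have hsumJ := J.sum_mem (t := K) (f := fun l => q * (- h b a * p ^ e + e * h l a * p ^ (e-1) * P (f l))) (fun l hl' => by
    simp only [hK, Finset.mem_filter, Finset.mem_univ, true_and] at hl'
    exact h1 l hl')
  have hcard : K.card = 2 * k := by
    have h2 : (Finset.univ.filter fun l => l ∈ Set.range lam).card = 2 * (r+1) := by
      have : (Finset.univ.filter fun l => l ∈ Set.range lam) = Finset.univ.image lam := by
        ext x; simp
      rw [this, Finset.card_image_of_injective _ hl]; simp
    have h3 := Finset.card_filter_add_card_filter_not (s := (Finset.univ : Finset (Fin (2*(m+1))))) (fun l => l ∈ Set.range lam)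
    rw [h2, Finset.card_univ, Fintype.card_fin] at h3
    change _ + K.card = _ at h3
    omega
  have hPlin : ∑ l, h l a * P (f l) = - P (u a) := by
    have : P = ((pf B (r+1)).toMultilinearMap.toLinearMap (f ∘ lam) β : V → R) := rfl
    rw [this, D.lin a, map_sum, ← Finset.sum_neg_distrib]
    exact Finset.sum_congr rfl fun l' _ => by rw [map_smul, smul_eq_mul, h_skew D l' a, neg_mul]
  have hsum : ∑ l, h l a * P (f l) = h b a * p + ∑ l ∈ K, h l a * P (f l) := by
    have hbK : b ∉ K := by simp [hK, hb]
    rw [← Finset.add_sum_erase _ _ (Finset.mem_univ b), hPb]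
    congr 1
    symm
    refine Finset.sum_subset (fun l' hl' => by
      refine Finset.mem_erase.mpr ⟨?_, Finset.mem_univ _⟩
      rintro rfl
      exact hbK hl') fun l' hl' hlK => ?_
    have hne := Finset.ne_of_mem_erase hl'
    simp only [hK, Finset.mem_filter, Finset.mem_univ, true_and, not_not] at hlK
    obtain ⟨c, rfl⟩ := hlK
    have hcβ : c ≠ β := by rintro rfl; exact hne rfl
    have : P (f (lam c)) = 0 := by
      refine (pf B (r+1)).map_eq_zero_of_eq _ (i := c) (j := β) ?_ hcβ
      rw [Function.update_of_ne hcβ, Function.update_self]; rfl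
    rw [this, mul_zero]
  have hder : Δ a b p = - P (u a) := by
    obtain ⟨ρ, hρ0, hρ1⟩ := exists_perm01 α β hαβ
    have e1 := der_cons2 D (fun i => lam (ρ (sh i))) a b hab
      (by rintro ⟨i, hi⟩; exact sh_ne0 (ρ.injective ((hl hi).trans hρ0.symm)))
      (by rintro ⟨i, hi⟩; exact sh_ne1 (ρ.injective ((hl hi).trans hρ1.symm)))
    have e2 : cons2 (f a) (f b) (f ∘ fun i => lam (ρ (sh i))) = (f ∘ lam) ∘ ρ := by
      rw [← cons2_eta ((f ∘ lam) ∘ ρ)]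
      simp only [Function.comp, hρ0, hρ1]; rfl
    have e3 := pf_u D (fun i => lam (ρ (sh i))) a
      (by rintro ⟨i, hi⟩; exact sh_ne0 (ρ.injective ((hl hi).trans hρ0.symm)))
    have e4 : cons2 (f a) (u a) (f ∘ fun i => lam (ρ (sh i))) = (Function.update (f ∘ lam) β (u a)) ∘ ρ := by
      funext c
      rcases idx_cases c with rfl | rfl | ⟨i, rfl⟩
      · rw [cons2_0, Function.comp, hρ0, Function.update_of_ne hαβ]; rfl
      · rw [cons2_1, Function.comp, hρ1, Function.update_self]
      · rw [cons2_sh, Function.comp, Function.comp, Function.update_of_ne]; rfl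
        rw [← hρ1]; exact fun h => sh_ne1 (ρ.injective h)
    rw [e2, AlternatingMap.map_perm] at e1
    rw [cons2_swap, e4, AlternatingMap.map_perm, ← e1] at e3
    rcases Int.units_eq_one_or (Equiv.Perm.sign ρ) with h | h <;> rw [h] at e3
    · simpa using e3.symm
    · simp only [Units.neg_smul, one_smul, neg_neg, map_neg] at e3
      simp only [hPdef, hp, e3, neg_neg]
  convert hsumJ using 1
  rw [← Finset.mul_sum, Finset.sum_add_distrib, Finset.sum_const, hcard, nsmul_eq_mul]
  have h5 : ∑ l ∈ K, (e : R) * h l a * p ^ (e-1) * P (f l) = e * p ^ (e-1) * ∑ l ∈ K, h l a * P (f l) := by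
    rw [Finset.mul_sum]
    exact Finset.sum_congr rfl fun l' _ => by ring
  have h6 : (e : R) * p ^ e = e * p ^ (e-1) * p := by
    cases e with
    | zero => simp
    | succ e => simp [pow_succ, mul_assoc]
  rw [h5, hder]
  push_cast
  linear_combination (q * e * p ^ (e-1)) * (hsum - hPlin) - q * h b a * h6

lemma main_case {r e k : ℕ} (J : Submodule S R) (lam : Fin (2*(r+1)) → Fin (2*(m+1))) (hl : Function.Injective lam)
    (hrk : r + 1 + k = m + 1)
    (hJ : ∀ f, Fr f → pf B (r+1) (f ∘ lam) ^ (e+1) ∈ J)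
    (f) (hf : Fr f) {Δ u h} (D : Dual B f Δ u h) (a b) :
    pf B (m+1) f * (e * pf B (r+1) (f ∘ lam) ^ (e-1) * Δ a b (pf B (r+1) (f ∘ lam))
      - (e + 2 * k) * h b a * pf B (r+1) (f ∘ lam) ^ e) ∈ J := by
  by_cases hab : a = b
  · subst hab
    rw [der_self D, h_self D]; simp
  rcases Nat.eq_zero_or_pos k with rfl | hk
  · obtain rfl : r = m := by omega
    convert J.zero_mem
    obtain ⟨π, hπ⟩ := exists_perm_of_range id lam hl (fun a => ⟨_, rfl⟩)
    have : f ∘ lam = f ∘ π := by rw [← hπ]; rfl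
    have h2 : Δ a b (pf B (r+1) (f ∘ lam)) = h b a * pf B (r+1) (f ∘ lam) := by
      have := der_full D a b
      rw [‹f ∘ lam = _›, AlternatingMap.map_perm]
      rcases Int.units_eq_one_or (Equiv.Perm.sign π) with h | h <;> rw [h] <;> simpa using this
    rw [h2]
    have h6 : (e : R) * pf B (r+1) (f ∘ lam) ^ e = e * pf B (r+1) (f ∘ lam) ^ (e-1) * pf B (r+1) (f ∘ lam) := by
      cases e with
      | zero => simp
      | succ e => simp [pow_succ, mul_assoc]
    push_cast
    linear_combination (-pf B (r+1) f * h b a) * h6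
  by_cases hin : a ∈ Set.range lam ∧ b ∈ Set.range lam
  · obtain ⟨⟨α, rfl⟩, ⟨β, rfl⟩⟩ := hin
    exact main_case_ii H J lam hl hrk hk hJ f hf D α β (fun h => hab (by rw [h]))
  rw [not_and_or] at hin
  have hPP : PP B Fr J e lam m := PP_all H.toFrSys J lam hl (by omega) hJ
  rw [der_zero D lam a b hin]
  obtain ⟨π, hπ0, hπ1⟩ := exists_perm01 a b hab
  obtain ⟨h1, h2, h3⟩ := perm_facts D π
  have hA := perm_h D π
  rw [hπ0] at h1 h3
  rw [hπ1] at h2 h3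
  rw [hπ0, hπ1] at hA
  have hνinj : Function.Injective (fun i => π (sh i)) := fun i j hh => sh_inj.mp (π.injective hh)
  have h4 : pf B m (f ∘ fun i => π (sh i)) * pf B (r+1) (f ∘ lam) ^ e ∈ J := by
    rcases hin with hin | hin
    · refine PP_one H.toFrSys J lam hl (by omega) hPP f hf _ hνinj b (fun c hc => ?_)
      rcases h3 (lam c) with h | h | h
      · exact absurd ⟨c, h⟩ hin
      · exact absurd h hc
      · exact h
    · refine PP_one H.toFrSys J lam hl (by omega) hPP f hf _ hνinj a (fun c hc => ?_)
      rcases h3 (lam c) with h | h | h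
      · exact absurd h hc
      · exact absurd ⟨c, h⟩ hin
      · exact h
  rw [← hA, mul_smul_comm, sign_mul_mem] at h4
  have h5 := C_smul_mem J h4 (-(e + 2 * k) : ℂ)
  convert h5 using 1
  simp only [map_neg, map_add, map_natCast, map_mul, map_ofNat]
  ring

end
end SkewLC

namespace SkewLC

section
variable {S : Type*} [CommRing S] [Algebra ℂ S]
variable {R : Type*} [CommRing R] [Algebra ℂ R] [Algebra S R] [IsScalarTower ℂ S R]
variable {V : Type*} [AddCommGroup V] [Module R V]
variable {B : V →ₗ[R] V →ₗ[R] R} {m : ℕ}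
variable {Fr : (Fin (2*(m+1)) → V) → Prop} {Pf Pi : R} {𝒟 : Submodule ℂ (Derivation ℂ R R)}

def NN (S : Type*) [CommRing S] [Algebra S R] (B : V →ₗ[R] V →ₗ[R] R) {m : ℕ} (Fr : (Fin (2*(m+1)) → V) → Prop)
    (Pi : R) {r : ℕ} (lam : Fin (2*r) → Fin (2*(m+1))) (k e : ℕ) : Submodule S R :=
  Submodule.span S {x | ∃ f, Fr f ∧ x = Pi ^ (e + 2 * k) * pf B r (f ∘ lam) ^ e}

lemma span_der (T : Submodule S R) (x : R) {ι : Type*} (Δ : ι → Derivation ℂ R R) (h : ∀ i, Δ i x ∈ T)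
    (d : Derivation ℂ R R) (hd : d ∈ Submodule.span ℂ (Set.range Δ)) : d x ∈ T := by
  induction hd using Submodule.span_induction with
  | mem d hd => obtain ⟨i, rfl⟩ := hd; exact h i
  | zero => simp
  | add d1 d2 _ _ h1 h2 => exact T.add_mem h1 h2
  | smul c d _ h1 => exact (T.restrictScalars ℂ).smul_mem c h1

variable (H : FrSys2 S B Fr Pf Pi 𝒟)
include H

lemma NN_stab {r k e : ℕ} (lam : Fin (2*(r+1)) → Fin (2*(m+1))) (hl : Function.Injective lam)
    (hrk : r + 1 + k = m + 1) (T : Submodule S R) (h0 : NN S B Fr Pi lam k e ≤ T) (h1 : NN S B Fr Pi lam k (e+1) ≤ T)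
    (hS : ∀ d ∈ 𝒟, ∀ s : S, ∃ s' : S, d (algebraMap S R s) = algebraMap S R s')
    (d) (hd : d ∈ 𝒟) (x : R) (hx : x ∈ NN S B Fr Pi lam k e) : d x ∈ T := by
  induction hx using Submodule.span_induction with
  | zero => simp
  | add x y _ _ h1 h2 => rw [map_add]; exact T.add_mem h1 h2
  | smul s x hx h2 =>
    rw [Algebra.smul_def, Derivation.leibniz, smul_eq_mul, smul_eq_mul]
    obtain ⟨s', hs'⟩ := hS d hd s
    refine T.add_mem ?_ ?_
    · rw [← Algebra.smul_def]; exact T.smul_mem _ h2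
    · rw [hs', mul_comm, ← Algebra.smul_def]; exact T.smul_mem _ (h0 hx)
  | mem x hx =>
    obtain ⟨f, hf, rfl⟩ := hx
    obtain ⟨Δ, u, h, D, hΔ, hspan⟩ := get_dual H f hf
    refine span_der T _ _ ?_ d (hspan hd)
    rintro ⟨a, b⟩
    obtain ⟨z, hz, hq⟩ := H.det f hf
    have hPi := der_Pi D Pf Pi H.mul z hz hq a b (e + 2 * k)
    set J : Submodule S R := T.comap (LinearMap.mulLeft S (Pi ^ (e + 1 + 2 * k))) with hJ
    have hmem : ∀ x, x ∈ J ↔ Pi ^ (e + 1 + 2 * k) * x ∈ T := fun x => Iff.rfl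
    have hmain := main_case H (e := e) J lam hl hrk (fun f hf => by
      rw [hmem]; exact h1 (Submodule.subset_span ⟨f, hf, rfl⟩)) f hf D a b
    rw [hq] at hmain
    have h3 := C_smul_mem J hmain z⁻¹
    rw [hmem] at h3
    convert h3 using 1
    simp only
    rw [Derivation.leibniz, hPi, Derivation.leibniz_pow]
    have hz1 : algebraMap ℂ R z⁻¹ * algebraMap ℂ R z = 1 := by rw [← map_mul, inv_mul_cancel₀ hz, map_one]
    have h4 : Pi ^ (e + 1 + 2 * k) = Pi ^ (e + 2 * k) * Pi := by ring
    rw [h4]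
    simp only [smul_eq_mul, nsmul_eq_mul]
    push_cast
    set X := (e * pf B (r+1) (f ∘ lam) ^ (e-1) * Δ a b (pf B (r+1) (f ∘ lam)) - (e + 2 * k) * h b a * pf B (r+1) (f ∘ lam) ^ e) with hX
    linear_combination (-Pi ^ (e + 2 * k) * Pi * Pf * X) * hz1 - (Pi ^ (e + 2 * k)  * X) * H.mul + Pi ^ (e + 2 * k) * hX

lemma cons2_inj {s n : ℕ} (a b : Fin n) (ν : Fin (2*s) → Fin n) (hab : a ≠ b) (ha : a ∉ Set.range ν) (hb : b ∉ Set.range ν)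
    (hν : Function.Injective ν) : Function.Injective (cons2 a b ν) := by
  intro i j hij
  rcases idx_cases i with rfl | rfl | ⟨i, rfl⟩ <;> rcases idx_cases j with rfl | rfl | ⟨j, rfl⟩ <;>
    simp only [cons2_0, cons2_1, cons2_sh] at hij
  · rfl
  · exact absurd hij hab
  · exact absurd ⟨j, hij.symm⟩ ha
  · exact absurd hij.symm hab
  · rfl
  · exact absurd ⟨j, hij.symm⟩ hb
  · exact absurd ⟨i, hij⟩ ha
  · exact absurd ⟨i, hij⟩ hb
  · rw [hν hij]

lemma NN_le {r k : ℕ} (lam : Fin (2*(r+1)) → Fin (2*(m+1))) (hl : Function.Injective lam)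
    (hrk : r + 1 + k = m + 1) (M : Submodule S R) (hM : ∀ d ∈ 𝒟, ∀ x ∈ M, d x ∈ M) (h0 : Pi ^ (2 * k) ∈ M) (e : ℕ) :
    ∀ f, Fr f → Pi ^ (e + 2 * k) * pf B (r+1) (f ∘ lam) ^ e ∈ M := by
  induction e with
  | zero => intro f _; simpa using h0
  | succ e ih =>
    have C : ∀ j, r + 1 + j ≤ m + 1 → ∀ s, s + j = m + 1 → ∀ f, Fr f → ∀ ν : Fin (2*s) → Fin (2*(m+1)), Function.Injective ν →
        (∀ a, lam a ∈ Set.range ν) → pf B s (f ∘ ν) * pf B (r+1) (f ∘ lam) ^ e * Pi ^ (e + 1 + 2 * k) ∈ M := by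
      intro j
      induction j with
      | zero =>
        intro _ s hs f hf ν hν _
        obtain rfl : s = m + 1 := by omega
        obtain ⟨π, hπ⟩ := exists_perm_of_range id ν hν (fun a => ⟨_, rfl⟩)
        have h1 : f ∘ ν = f ∘ π := by rw [← hπ]; rfl
        obtain ⟨z, hz, hq⟩ := H.det f hf
        rw [h1, AlternatingMap.map_perm, hq, mul_assoc, sign_mul_mem]
        have := C_smul_mem M (ih f hf) z
        convert this using 1
        linear_combination (algebraMap ℂ R z * pf B (r+1) (f ∘ lam) ^ e * Pi ^ (e + 2 * k)) * H.mul
      | succ j IH =>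
        intro hj s hs f hf ν hν hr
        have IH := IH (by omega) (s+1) (by omega) f hf
        obtain ⟨Δ, u, h, D, hΔ, hspan⟩ := get_dual H f hf
        obtain ⟨z, hz, hq⟩ := H.det f hf
        obtain ⟨a, ha⟩ : ∃ a, a ∉ Set.range ν := exists_not_mem id Function.injective_id ν (by omega)
        classical
        set K : Finset (Fin (2*(m+1))) := Finset.univ.filter fun b => b ≠ a ∧ b ∉ Set.range ν with hK
        have hmemK : ∀ b, b ∈ K ↔ b ≠ a ∧ b ∉ Set.range ν := by simp [hK]
        set t := pf B s (f ∘ ν) with ht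
        set p := pf B (r+1) (f ∘ lam) with hp
        set N := e + 1 + 2 * k with hN
        have h1 : ∀ b ∈ K, (t - N * (h b a * pf B (s+1) (cons2 (f a) (f b) (f ∘ ν)))) * p ^ e * Pi ^ N ∈ M := by
          intro b hb
          rw [hmemK] at hb
          have h2 := IH (cons2 a b ν) (cons2_inj H a b ν hb.1.symm ha hb.2 hν) (fun c => by
            obtain ⟨i, hi⟩ := hr c
            exact ⟨sh i, hi⟩)
          have h3 := hM _ (hΔ a b) _ h2
          convert h3 using 1
          have h4 : Δ a b p = 0 := der_zero D lam a b (Or.inl (by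
            rintro ⟨c, rfl⟩
            exact ha (hr c)))
          have h4' : Δ a b (p ^ e) = 0 := by rw [Derivation.leibniz_pow, h4]; simp
          rw [cons2_comp, Derivation.leibniz, Derivation.leibniz, h4',
            der_cons2 D ν a b hb.1.symm ha hb.2, der_Pi D Pf Pi H.mul z hz hq]
          simp only [smul_eq_mul, smul_zero]
          ring
        have h2 := M.sum_mem h1
        have hcard : K.card + 2 * s + 1 = 2 * (m + 1) := by
          have e1 : (Finset.univ : Finset (Fin (2*(m+1)))) = insert a (K ∪ Finset.univ.image ν) := by
            ext x
            simp only [Finset.mem_univ, Finset.mem_insert, Finset.mem_union, hmemK, true_iff, Finset.mem_image, true_and]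
            by_cases hxa : x = a
            · exact Or.inl hxa
            · by_cases hx : x ∈ Set.range ν
              · exact Or.inr (Or.inr hx)
              · exact Or.inr (Or.inl ⟨hxa, hx⟩)
          have e2 := congrArg Finset.card e1
          rw [Finset.card_insert_of_notMem, Finset.card_union_of_disjoint, Finset.card_image_of_injective _ hν] at e2
          · simp at e2; omega
          · rw [Finset.disjoint_left]
            intro x hx hx2
            rw [hmemK] at hx
            simp only [Finset.mem_image, Finset.mem_univ, true_and] at hx2
            exact hx.2 hx2
          · simp only [Finset.mem_union, hmemK, Finset.mem_image, Finset.mem_univ, true_and, ne_eq, not_true, false_and, false_or]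
            exact ha
        have hsum : ∑ b ∈ K, h b a * pf B (s+1) (cons2 (f a) (f b) (f ∘ ν)) = t := by
          rw [ht, ← sum_h' D ν a ha]
          refine Finset.sum_subset (Finset.subset_univ _) fun b _ hb => ?_
          rw [hmemK, not_and_or, not_not, not_not] at hb
          rw [pf_rep ν a b hb, mul_zero]
        rw [← Finset.sum_mul, ← Finset.sum_mul, Finset.sum_sub_distrib, Finset.sum_const, ← Finset.mul_sum, hsum, nsmul_eq_mul] at h2
        have hNK : K.card + (N - K.card) = N := by omega
        refine nat_cancel M (N - K.card) (by omega) ?_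
        rw [← neg_mem_iff]
        convert h2 using 1
        have h5 : (K.card : R) + ((N - K.card : ℕ) : R) = N := by rw [← Nat.cast_add, hNK]
        linear_combination (-(t * p ^ e * Pi ^ N)) * h5
    intro f hf
    have := C k (by omega) (r+1) (by omega) f hf lam hl (fun a => ⟨a, rfl⟩)
    convert this using 1
    ring

end
end SkewLC

namespace SkewLC

section
variable {S : Type*} [CommRing S] [Algebra ℂ S]
variable {R : Type*} [CommRing R] [Algebra ℂ R] [Algebra S R] [IsScalarTower ℂ S R]
variable {V : Type*} [AddCommGroup V] [Module R V]
variable {B : V →ₗ[R] V →ₗ[R] R} {m : ℕ}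
variable {Fr : (Fin (2*(m+1)) → V) → Prop} {Pf Pi : R} {𝒟 : Submodule ℂ (Derivation ℂ R R)}

lemma exists_perm_ext {a N : ℕ} (f g : Fin a → Fin N) (hf : Function.Injective f) (hg : Function.Injective g) :
    ∃ π : Equiv.Perm (Fin N), π ∘ f = g := by
  classical
  let e : {x // x ∈ Set.range f} ≃ {x // x ∈ Set.range g} :=
    (Equiv.ofInjective f hf).symm.trans (Equiv.ofInjective g hg)
  refine ⟨e.extendSubtype, funext fun i => ?_⟩
  have := e.extendSubtype_apply_of_mem (f i) ⟨i, rfl⟩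
  simp only [Function.comp_apply, this, e, Equiv.trans_apply]
  have h2 : (Equiv.ofInjective f hf).symm ⟨f i, ⟨i, rfl⟩⟩ = i := Equiv.ofInjective_symm_apply hf i
  rw [h2]; rfl

variable (H : FrSys2 S B Fr Pf Pi 𝒟)
include H

lemma Pi_mem_NN {r k : ℕ} (lam : Fin (2*(r+1)) → Fin (2*(m+1))) (hl : Function.Injective lam)
    (hrk : r + 1 + k = m + 1) (f) (hf : Fr f) : Pi ^ (2 * k) ∈ NN S B Fr Pi lam k 1 := by
  set J : Submodule S R := (NN S B Fr Pi lam k 1).comap (LinearMap.mulLeft S (Pi ^ (1 + 2 * k))) with hJ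
  have h1 : PP B Fr J 0 lam (m+1) := by
    refine PP_all H.toFrSys J lam hl (by omega) fun f hf => ?_
    exact Submodule.subset_span ⟨f, hf, rfl⟩
  have h2 := h1 f hf id Function.injective_id (fun a => ⟨lam a, rfl⟩)
  obtain ⟨z, hz, hq⟩ := H.det f hf
  have h3 : Pi ^ (1 + 2 * k) * (pf B (m+1) (f ∘ id) * pf B (r+1) (f ∘ lam) ^ 0) ∈ NN S B Fr Pi lam k 1 := h2
  rw [Function.comp_id, hq] at h3
  have h4 := (NN S B Fr Pi lam k 1).smul_mem (algebraMap ℂ S z⁻¹) h3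
  convert h4 using 1
  rw [Algebra.smul_def, ← IsScalarTower.algebraMap_apply]
  have h5 : algebraMap ℂ R z⁻¹ * algebraMap ℂ R z = 1 := by rw [← map_mul, inv_mul_cancel₀ hz, map_one]
  linear_combination (-(Pi ^ (2*k))) * H.mul - (Pi ^ (2*k) * Pi * Pf) * h5

lemma NN_mono {r k e : ℕ} (lam : Fin (2*(r+1)) → Fin (2*(m+1))) (hl : Function.Injective lam)
    (lam' : Fin (2*r) → Fin (2*(m+1))) (hl' : Function.Injective lam') (s : S) (hs : algebraMap S R s = Pf) :
    NN S B Fr Pi lam k e ≤ NN S B Fr Pi lam' (k+1) e := by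
  refine Submodule.span_le.mpr ?_
  rintro x ⟨f, hf, rfl⟩
  set J : Submodule S R := (NN S B Fr Pi lam' (k+1) e).comap (LinearMap.mulLeft S (Pi ^ (e + 2 * (k+1)))) with hJ
  have h1 : pf B (r+1) (f ∘ lam) ^ e ∈ J := by
    refine A_main H.toFrSys J lam hl (fun f hf => ?_) f hf
    obtain ⟨π, hπ⟩ := exists_perm_ext lam' (fun i => lam (sh i)) hl' (fun i j h => sh_inj.mp (hl h))
    refine Submodule.subset_span ⟨f ∘ π, H.perm f hf π, ?_⟩
    rw [Function.comp_assoc, hπ]; rfl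
  have h2 : Pi ^ (e + 2 * (k+1)) * pf B (r+1) (f ∘ lam) ^ e ∈ NN S B Fr Pi lam' (k+1) e := h1
  have h3 := (NN S B Fr Pi lam' (k+1) e).smul_mem (s ^ 2) h2
  rw [SetLike.mem_coe]
  convert h3 using 1
  rw [Algebra.smul_def, map_pow, hs]
  linear_combination (-(Pi ^ (e+2*k) * pf B (r+1) (f ∘ lam) ^ e) * (Pf * Pi + 1)) * H.mul

lemma NN_iSup_stab {r k : ℕ} (lam : Fin (2*(r+1)) → Fin (2*(m+1))) (hl : Function.Injective lam)
    (hrk : r + 1 + k = m + 1)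
    (hS : ∀ d ∈ 𝒟, ∀ s : S, ∃ s' : S, d (algebraMap S R s) = algebraMap S R s')
    (d) (hd : d ∈ 𝒟) (x : R) (hx : x ∈ ⨆ e : ℕ, NN S B Fr Pi lam k (e+1)) :
    d x ∈ ⨆ e : ℕ, NN S B Fr Pi lam k (e+1) := by
  induction hx using Submodule.iSup_induction' with
  | mem e x hx =>
    exact NN_stab H lam hl hrk _ (le_iSup (fun e => NN S B Fr Pi lam k (e+1)) e)
      (le_iSup (fun e => NN S B Fr Pi lam k (e+1)) (e+1)) hS d hd x hx
  | zero => simp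
  | add x y _ _ h1 h2 => rw [map_add]; exact Submodule.add_mem _ h1 h2

end
end SkewLC

namespace SkewLC

section

lemma genEntry_self (n : ℕ) (i : Fin n) : genEntry n i i = 0 := by simp [genEntry]
lemma genEntry_swap (n : ℕ) (i j : Fin n) : genEntry n i j = - genEntry n j i := by
  unfold genEntry
  rcases lt_trichotomy i j with h | rfl | h
  · simp [h, not_lt_of_gt h]
  · simp
  · simp [h, not_lt_of_gt h]

def BF (n : ℕ) : (Fin n → SPf n) →ₗ[SPf n] (Fin n → SPf n) →ₗ[SPf n] SPf n :=
  Matrix.toLinearMap₂' (SPf n) (Matrix.of fun i j => algebraMap (PS n) (SPf n) (genEntry n i j))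

lemma BF_apply (n : ℕ) (v w : Fin n → SPf n) :
    BF n v w = ∑ a, ∑ b, v a * w b * algebraMap (PS n) (SPf n) (genEntry n a b) := by
  rw [BF, Matrix.toLinearMap₂'_apply]
  simp [mul_assoc]

lemma BF_alt (n : ℕ) (v : Fin n → SPf n) : BF n v v = 0 := by
  have h : BF n v v = - BF n v v := by
    conv_lhs => rw [BF_apply, Finset.sum_comm]
    rw [BF_apply, ← Finset.sum_neg_distrib]
    refine Finset.sum_congr rfl fun a _ => ?_
    rw [← Finset.sum_neg_distrib]
    refine Finset.sum_congr rfl fun b _ => ?_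
    rw [genEntry_swap n b a, map_neg]; ring
  have h2 : (2:ℂ) • BF n v v = 0 := by
    rw [two_smul]; nth_rw 1 [h]; simp
  have h3 := congrArg (fun x => (2:ℂ)⁻¹ • x) h2
  simpa [smul_smul] using h3

def vec {n : ℕ} (g : Matrix (Fin n) (Fin n) ℂ) : Fin n → Fin n → SPf n :=
  fun i a => algebraMap ℂ (SPf n) (g i a)

def glEnt {n : ℕ} (g : Matrix (Fin n) (Fin n) ℂ) (i j : Fin n) : PS n :=
  ∑ a : Fin n, ∑ b : Fin n, (g i a * g j b) • genEntry n a b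

lemma BF_vec {n : ℕ} (g : Matrix (Fin n) (Fin n) ℂ) (i j : Fin n) :
    BF n (vec g i) (vec g j) = algebraMap (PS n) (SPf n) (glEnt g i j) := by
  rw [BF_apply, glEnt, map_sum]
  refine Finset.sum_congr rfl fun a _ => ?_
  rw [map_sum]
  refine Finset.sum_congr rfl fun b _ => ?_
  rw [Algebra.smul_def, map_mul, ← IsScalarTower.algebraMap_apply, map_mul]; rfl

lemma glEnt_swap {n : ℕ} (g : Matrix (Fin n) (Fin n) ℂ) (i j : Fin n) : glEnt g i j = - glEnt g j i := by
  unfold glEnt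
  rw [Finset.sum_comm, ← Finset.sum_neg_distrib]
  refine Finset.sum_congr rfl fun a _ => ?_
  rw [← Finset.sum_neg_distrib]
  refine Finset.sum_congr rfl fun b _ => ?_
  rw [genEntry_swap n b a, smul_neg, mul_comm]

lemma glEnt_self {n : ℕ} (g : Matrix (Fin n) (Fin n) ℂ) (i : Fin n) : glEnt g i i = 0 :=
  self_eq_neg.mp (glEnt_swap g i i)

lemma glMap_genEntry {n : ℕ} (g : Matrix (Fin n) (Fin n) ℂ) (i j : Fin n) :
    glMap n g (genEntry n i j) = glEnt g i j := by
  have hlt : ∀ i j (h : i < j), glMap n g (MvPolynomial.X ⟨(i, j), h⟩) = glEnt g i j := by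
    intro i j h
    rw [glMap, MvPolynomial.aeval_X]; rfl
  rcases lt_trichotomy i j with h | rfl | h
  · rw [genEntry, dif_pos h, hlt]
  · rw [genEntry_self, glEnt_self, map_zero]
  · rw [genEntry, dif_neg (not_lt_of_gt h), dif_pos h, map_neg, hlt, glEnt_swap]; simp

def FrC (n : ℕ) (f : Fin n → Fin n → SPf n) : Prop :=
  ∃ g : Matrix (Fin n) (Fin n) ℂ, g.det ≠ 0 ∧ f = vec g

lemma FrC_sys (n : ℕ) : FrSys (PS n) (BF n) (FrC n) where
  alt := BF_alt n
  add := by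
    rintro f ⟨g, hg, rfl⟩ i l hil τ
    refine ⟨g.updateRow i (g i + τ • g l), ?_, ?_⟩
    · rwa [Matrix.det_updateRow_add_smul_self _ hil]
    · funext x a
      by_cases hx : x = i
      · subst hx; simp [vec, Algebra.smul_def]
      · simp [vec, hx]
  perm := by
    rintro f ⟨g, hg, rfl⟩ π
    refine ⟨g.submatrix π id, ?_, rfl⟩
    rw [Matrix.det_permute]
    refine mul_ne_zero ?_ hg
    rcases Int.units_eq_one_or (Equiv.Perm.sign π) with h | h <;> simp [h]
  int := by
    rintro f ⟨g, hg, rfl⟩ i j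
    exact ⟨_, (BF_vec g i j).symm⟩

lemma pf_glMap {n r : ℕ} (h : 2 * r ≤ n) (g : Matrix (Fin n) (Fin n) ℂ) :
    algebraMap (PS n) (SPf n) (glMap n g (pfBlock n r)) = pf (BF n) r (vec g ∘ Fin.castLE h) := by
  rw [pfBlock, dif_pos h, pf_apply', cst, map_smul, Algebra.smul_def, map_mul, ← IsScalarTower.algebraMap_apply]
  congr 1
  rw [map_sum, map_sum]
  refine Finset.sum_congr rfl fun σ _ => ?_
  rw [map_zsmul, map_zsmul, map_prod, map_prod]
  congr 1
  refine Finset.prod_congr rfl fun i _ => ?_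
  rw [glMap_genEntry, Function.comp_apply, Function.comp_apply, BF_vec]
  rfl

lemma glMap_one (n : ℕ) (x : PS n) : glMap n 1 x = x := by
  have : glMap n 1 = AlgHom.id ℂ (PS n) := by
    refine MvPolynomial.algHom_ext fun p => ?_
    rcases p with ⟨⟨i, j⟩, hp⟩
    have h1 : (MvPolynomial.X ⟨(i, j), hp⟩ : PS n) = genEntry n i j := by
      rw [genEntry, dif_pos (show i < j from hp)]
    rw [AlgHom.id_apply, h1, glMap_genEntry, glEnt]
    simp [Matrix.one_apply]
  rw [this]; rfl

lemma pf_full {m : ℕ} : algebraMap (PS (2*(m+1))) (SPf (2*(m+1))) (pfaffian (2*(m+1))) =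
    pf (BF (2*(m+1))) (m+1) (vec 1) := by
  have h := pf_glMap (n := 2*(m+1)) (r := m+1) le_rfl 1
  rw [glMap_one] at h
  have hp : pfaffian (2*(m+1)) = pfBlock (2*(m+1)) (m+1) := by
    unfold pfaffian; congr 1; omega
  exact (congrArg _ hp).trans h

lemma vec_one (n : ℕ) : vec (1 : Matrix (Fin n) (Fin n) ℂ) = Pi.basisFun (SPf n) (Fin n) := by
  funext i a
  by_cases h : i = a
  · subst h; simp [vec]
  · simp [vec, h, Ne.symm h]

lemma pf_det {m : ℕ} (g : Matrix (Fin (2*(m+1))) (Fin (2*(m+1))) ℂ) :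
    pf (BF (2*(m+1))) (m+1) (vec g) = algebraMap ℂ _ g.det *
      algebraMap (PS (2*(m+1))) (SPf (2*(m+1))) (pfaffian (2*(m+1))) := by
  rw [pf_full, vec_one]
  set b := Pi.basisFun (SPf (2*(m+1))) (Fin (2*(m+1)))
  have h := AlternatingMap.eq_smul_basis_det b (pf (BF (2*(m+1))) (m+1))
  have h2 := congrArg (fun F => F (vec g)) h
  simp only [AlternatingMap.smul_apply, smul_eq_mul] at h2
  refine h2.trans ((mul_comm _ _).trans ?_)
  congr 1
  rw [Pi.basisFun_det_apply]
  have : Matrix.of (vec g) = (algebraMap ℂ (SPf (2*(m+1)))).mapMatrix g := rfl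
  rw [this, ← RingHom.map_det]

end
end SkewLC

namespace SkewLC

section

def tw {n : ℕ} {E : Type*} [AddCommGroup E] [Module ℂ E] (h : Matrix (Fin n) (Fin n) ℂ) (T : Fin n → Fin n → E)
    (a b : Fin n) : E := ∑ c, ∑ d, (h c a * h d b) • T c d

lemma sum4 {n : ℕ} {E : Type*} [AddCommGroup E] (F : Fin n → Fin n → Fin n → Fin n → E) :
    ∑ a, ∑ b, ∑ c, ∑ d, F a b c d = ∑ c, ∑ d, ∑ a, ∑ b, F a b c d := by
  have h1 : ∀ a, ∑ b, ∑ c, ∑ d, F a b c d = ∑ c, ∑ d, ∑ b, F a b c d := by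
    intro a
    rw [Finset.sum_comm]
    exact Finset.sum_congr rfl fun c _ => Finset.sum_comm
  rw [Finset.sum_congr rfl fun a _ => h1 a, Finset.sum_comm]
  exact Finset.sum_congr rfl fun c _ => Finset.sum_comm

lemma tw_tw {n : ℕ} {E : Type*} [AddCommGroup E] [Module ℂ E] (g h : Matrix (Fin n) (Fin n) ℂ) (T : Fin n → Fin n → E) :
    tw g (tw h T) = tw (h * g) T := by
  funext c d
  simp only [tw, Matrix.mul_apply, Finset.smul_sum, Finset.sum_mul_sum, Finset.sum_smul, smul_smul]
  rw [sum4]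
  refine Finset.sum_congr rfl fun a _ => Finset.sum_congr rfl fun b _ => Finset.sum_congr rfl fun a' _ =>
    Finset.sum_congr rfl fun b' _ => ?_
  congr 1; ring

lemma tw_one {n : ℕ} {E : Type*} [AddCommGroup E] [Module ℂ E] (T : Fin n → Fin n → E) :
    tw 1 T = T := by
  funext c d
  simp [tw, Matrix.one_apply]

variable {n : ℕ} (δ : SkewIdx n → Derivation ℂ (SPf n) (SPf n))

def pd (c d : Fin n) : Derivation ℂ (SPf n) (SPf n) :=
  if h : c < d then δ ⟨(c, d), h⟩ else if h' : d < c then - δ ⟨(d, c), h'⟩ else 0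

lemma pderiv_gen (c d : Fin n) (h : c < d) (i j : Fin n) :
    MvPolynomial.pderiv (⟨(c, d), h⟩ : SkewIdx n) (genEntry n i j) =
      (if i = c ∧ j = d then 1 else 0) - (if i = d ∧ j = c then 1 else 0) := by
  rcases lt_trichotomy i j with hij | rfl | hij
  · rw [genEntry, dif_pos hij, MvPolynomial.pderiv_X, Pi.single_apply,
      if_neg (show ¬ (i = d ∧ j = c) by rintro ⟨rfl, rfl⟩; exact lt_asymm h hij), sub_zero]
    simp [Prod.ext_iff]
  · rw [genEntry_self, map_zero, if_neg, if_neg, sub_zero]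
    · rintro ⟨rfl, rfl⟩; exact lt_irrefl _ h
    · rintro ⟨rfl, rfl⟩; exact lt_irrefl _ h
  · rw [genEntry, dif_neg (not_lt_of_gt hij), dif_pos hij, map_neg, MvPolynomial.pderiv_X, Pi.single_apply,
      if_neg (show ¬ (i = c ∧ j = d) by rintro ⟨rfl, rfl⟩; exact lt_asymm h hij), zero_sub]
    simp [Prod.ext_iff, and_comm]

variable (hδ : IsDerivExtension n δ)
include hδ

lemma pd_gen (c d i j : Fin n) :
    pd δ c d (algebraMap (PS n) (SPf n) (genEntry n i j)) =
      (if i = c ∧ j = d then 1 else 0) - (if i = d ∧ j = c then 1 else 0) := by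
  have key : ∀ c d (h : c < d), δ ⟨(c,d),h⟩ (algebraMap (PS n) (SPf n) (genEntry n i j)) =
      (if i = c ∧ j = d then 1 else 0) - (if i = d ∧ j = c then 1 else 0) := by
    intro c d h
    rw [hδ, pderiv_gen, map_sub]
    congr 1 <;> split_ifs <;> simp
  rcases lt_trichotomy c d with h | rfl | h
  · rw [pd, dif_pos h, key]
  · rw [pd, dif_neg (lt_irrefl _), dif_neg (lt_irrefl _)]; simp
  · rw [pd, dif_neg (not_lt_of_gt h), dif_pos h, Derivation.neg_apply, key]; ring

lemma pd_glEnt (g : Matrix (Fin n) (Fin n) ℂ) (c d i j : Fin n) :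
    pd δ c d (algebraMap (PS n) (SPf n) (glEnt g i j)) =
      algebraMap ℂ (SPf n) (g i c * g j d - g i d * g j c) := by
  have h1 : algebraMap (PS n) (SPf n) (glEnt g i j) =
      ∑ a : Fin n, ∑ b : Fin n, (g i a * g j b) • algebraMap (PS n) (SPf n) (genEntry n a b) := by
    rw [glEnt, map_sum]
    refine Finset.sum_congr rfl fun a _ => ?_
    rw [map_sum]
    refine Finset.sum_congr rfl fun b _ => ?_
    rw [Algebra.smul_def, map_mul, ← IsScalarTower.algebraMap_apply, Algebra.smul_def]
  rw [h1]
  simp only [map_sum, Derivation.map_smul, pd_gen δ hδ, smul_sub, Finset.sum_sub_distrib, ite_and]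
  simp [Algebra.smul_def]

lemma tw_glEnt (g h : Matrix (Fin n) (Fin n) ℂ) (hgh : g * h = 1) (a b i j : Fin n) :
    tw h (pd δ) a b (algebraMap (PS n) (SPf n) (glEnt g i j)) =
      (if i = a ∧ j = b then 1 else 0) - (if i = b ∧ j = a then 1 else 0) := by
  have e1 : ∀ x y, ∑ c, g x c * h c y = if x = y then 1 else 0 := by
    intro x y
    rw [← Matrix.mul_apply, hgh, Matrix.one_apply]
  have e2 : ∑ c, ∑ d, (h c a * h d b) * (g i c * g j d - g i d * g j c) =
      (if i = a ∧ j = b then 1 else 0) - (if i = b ∧ j = a then 1 else 0) := by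
    have e3 : ∑ c, ∑ d, (h c a * h d b) * (g i c * g j d - g i d * g j c) =
       (∑ c, g i c * h c a) * (∑ d, g j d * h d b) - (∑ c, g j c * h c a) * (∑ d, g i d * h d b) := by
      rw [Finset.sum_mul_sum, Finset.sum_mul_sum, ← Finset.sum_sub_distrib]
      refine Finset.sum_congr rfl fun c _ => ?_
      rw [← Finset.sum_sub_distrib]
      refine Finset.sum_congr rfl fun d _ => ?_
      ring
    rw [e3, e1, e1, e1, e1]
    congr 1
    · simp only [ite_and, ite_mul, one_mul, zero_mul]
    · rw [mul_comm]; simp only [ite_and, ite_mul, one_mul, zero_mul]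
  have e4 : tw h (pd δ) a b (algebraMap (PS n) (SPf n) (glEnt g i j)) =
      algebraMap ℂ (SPf n) (∑ c, ∑ d, (h c a * h d b) * (g i c * g j d - g i d * g j c)) := by
    rw [tw, ← Derivation.coeFnAddMonoidHom_apply, map_sum, Finset.sum_apply, map_sum]
    refine Finset.sum_congr rfl fun c _ => ?_
    rw [map_sum, Finset.sum_apply, map_sum]
    refine Finset.sum_congr rfl fun d _ => ?_
    rw [Derivation.coeFnAddMonoidHom_apply, Derivation.smul_apply, pd_glEnt δ hδ, map_mul, Algebra.smul_def]
  rw [e4, e2, map_sub]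
  congr 1 <;> split_ifs <;> simp

omit hδ
lemma pd_mem (c d : Fin n) : pd δ c d ∈ Submodule.span ℂ (Set.range δ) := by
  unfold pd
  split_ifs
  · exact Submodule.subset_span ⟨_, rfl⟩
  · exact Submodule.neg_mem _ (Submodule.subset_span ⟨_, rfl⟩)
  · exact Submodule.zero_mem _

end

section
variable {m : ℕ} (δ : SkewIdx (2*(m+1)) → Derivation ℂ (SPf (2*(m+1))) (SPf (2*(m+1))))
  (hδ : IsDerivExtension (2*(m+1)) δ)
include hδ

lemma sys : FrSys2 (PS (2*(m+1))) (BF (2*(m+1))) (FrC (2*(m+1)))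
    (algebraMap (PS (2*(m+1))) (SPf (2*(m+1))) (pfaffian (2*(m+1)))) (pfInv (2*(m+1)))
    (Submodule.span ℂ (Set.range δ)) where
  toFrSys := FrC_sys _
  mul := IsLocalization.Away.mul_invSelf _
  det := by
    rintro f ⟨g, hg, rfl⟩
    exact ⟨g.det, hg, pf_det g⟩
  der := by
    rintro f ⟨g, hg, rfl⟩
    have hu : IsUnit g.det := IsUnit.mk0 _ hg
    refine ⟨tw g⁻¹ (pd δ), ?_, ?_, ?_⟩
    · intro a b i j
      rw [BF_vec]
      exact tw_glEnt δ hδ g g⁻¹ (Matrix.mul_nonsing_inv g hu) a b i j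
    · intro a b
      exact Submodule.sum_mem _ fun c _ => Submodule.sum_mem _ fun d _ => Submodule.smul_mem _ _ (pd_mem δ c d)
    · rw [Submodule.span_le]
      rintro _ ⟨⟨⟨c, d⟩, hcd⟩, rfl⟩
      have h1 : δ ⟨(c, d), hcd⟩ = tw g (tw g⁻¹ (pd δ)) c d := by
        rw [tw_tw, Matrix.nonsing_inv_mul g hu, tw_one, pd, dif_pos (show c < d from hcd)]
      rw [h1]
      exact Submodule.sum_mem _ fun a _ => Submodule.sum_mem _ fun b _ => Submodule.smul_mem _ _
        (Submodule.subset_span ⟨(a, b), rfl⟩)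

lemma sysS (d) (hd : d ∈ Submodule.span ℂ (Set.range δ)) (s : PS (2*(m+1))) :
    ∃ s' : PS (2*(m+1)), d (algebraMap _ (SPf (2*(m+1))) s) = algebraMap _ _ s' := by
  have := span_der (S := PS (2*(m+1))) (LinearMap.range (Algebra.linearMap (PS (2*(m+1))) (SPf (2*(m+1)))))
    (algebraMap _ (SPf (2*(m+1))) s) δ (fun p => ⟨_, (hδ p s).symm⟩) d hd
  obtain ⟨s', h⟩ := this
  exact ⟨s', h.symm⟩

end

section

lemma hw_rect (n r e : ℕ) (hr : r + 1 ≤ n / 2) : hwVector n (rect (r+1) e) = pfBlock n (r+1) ^ e := by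
  rw [hwVector, Finset.prod_eq_single r]
  · simp [rect]
  · intro i _ hi
    have : rect (r+1) e i - rect (r+1) e (i+1) = 0 := by
      simp only [rect]; split_ifs <;> omega
    rw [this, pow_zero]
  · intro h; exact absurd (Finset.mem_range.mpr (by omega)) h

lemma NMod_eq {m r k : ℕ} (e : ℕ) (hrk : r + 1 + k = m + 1) :
    NMod (2*(m+1)) k e = NN (PS (2*(m+1))) (BF (2*(m+1))) (FrC (2*(m+1))) (pfInv (2*(m+1)))
      (Fin.castLE (show 2*(r+1) ≤ 2*(m+1) by omega)) k e := by
  rw [NMod, show 2*(m+1)/2 - k = r+1 by omega, invIdeal, hw_rect _ _ _ (by omega), NN, Ideal.span, Submodule.map_span]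
  congr 1
  ext x
  constructor
  · rintro ⟨_, ⟨g, rfl⟩, rfl⟩
    refine ⟨vec g.val, ⟨g.val, g.det_ne_zero, rfl⟩, ?_⟩
    rw [← pf_glMap, ← map_pow, ← map_pow]; rfl
  · rintro ⟨_, ⟨g, hg, rfl⟩, rfl⟩
    refine ⟨_, ⟨Matrix.GeneralLinearGroup.mkOfDetNeZero g hg, rfl⟩, ?_⟩
    rw [← pf_glMap, ← map_pow, ← map_pow]; rfl

lemma vec_one_FrC (n : ℕ) : FrC n (vec 1) := ⟨1, by simp, rfl⟩

lemma dSpan_main {m r k : ℕ} (δ : SkewIdx (2*(m+1)) → Derivation ℂ (SPf (2*(m+1))) (SPf (2*(m+1))))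
    (hδ : IsDerivExtension (2*(m+1)) δ) (hrk : r + 1 + k = m + 1) :
    dSpan (2*(m+1)) δ (pfInv (2*(m+1)) ^ (2 * k)) = ⨆ e : ℕ, NMod (2*(m+1)) k (e + 1) := by
  have H := sys δ hδ
  have hinj : Function.Injective (Fin.castLE (show 2*(r+1) ≤ 2*(m+1) by omega)) := Fin.castLE_injective _
  simp only [NMod_eq _ hrk]
  apply le_antisymm
  · refine sInf_le ⟨?_, ?_⟩
    · have h1 := Pi_mem_NN H _ hinj hrk _ (vec_one_FrC _)
      exact Submodule.mem_iSup_of_mem 0 h1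
    · intro p x hx
      exact NN_iSup_stab H _ hinj hrk (sysS δ hδ) (δ p) (Submodule.subset_span ⟨p, rfl⟩) x hx
  · refine iSup_le fun e => le_sInf ?_
    rintro M ⟨hv, hM⟩
    refine Submodule.span_le.mpr ?_
    rintro _ ⟨f, hf, rfl⟩
    exact NN_le H _ hinj hrk M (fun d hd x hx => span_der M x δ (fun p => hM p x hx) d hd) hv (e+1) f hf

lemma NMod_mono {m r k : ℕ} (δ : SkewIdx (2*(m+1)) → Derivation ℂ (SPf (2*(m+1))) (SPf (2*(m+1))))
    (hδ : IsDerivExtension (2*(m+1)) δ) (hrk : r + 1 + (k+1) = m + 1) (e : ℕ) :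
    NMod (2*(m+1)) k e ≤ NMod (2*(m+1)) (k+1) e := by
  rw [NMod_eq (r := r+1) e (by omega), NMod_eq (r := r) e hrk]
  exact NN_mono (sys δ hδ) _ (Fin.castLE_injective _) _ (Fin.castLE_injective _) _ rfl

lemma dSpan_mono {m : ℕ} (k : ℕ) (δ : SkewIdx (2*(m+1)) → Derivation ℂ (SPf (2*(m+1))) (SPf (2*(m+1)))) :
    dSpan (2*(m+1)) δ (pfInv (2*(m+1)) ^ (2 * k)) ≤ dSpan (2*(m+1)) δ (pfInv (2*(m+1)) ^ (2 * (k+1))) := by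
  refine le_sInf ?_
  rintro M ⟨hv, hM⟩
  refine sInf_le ⟨?_, hM⟩
  have h := M.smul_mem (pfaffian (2*(m+1)) ^ 2) hv
  convert h using 1
  have hmul : algebraMap (PS (2*(m+1))) (SPf (2*(m+1))) (pfaffian (2*(m+1))) * pfInv (2*(m+1)) = 1 :=
    IsLocalization.Away.mul_invSelf _
  rw [Algebra.smul_def, map_pow, show 2 * (k+1) = 2 * k + 2 by ring, pow_add, mul_left_comm, ← mul_pow, hmul, one_pow, mul_one]

end
end SkewLC

namespace SkewLC

open CategoryTheory

/-- Let `n = 2m` be even and `0 ≤ k ≤ m-1`.  Then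
`⟨Pf^{-2k}⟩_𝒟 = ⋃_{e ≥ 1} 𝒩_{k,e}`: the `𝒟_X`-submodule of `S_Pf` generated
by `Pf^{-2k}` is the direct limit (here: supremum, i.e. increasing union) of
the `S`-submodules `𝒩_{k,e} = I_{(m-k)×e} ⊗_S 𝒫_{-e-2k} ⊆ S_Pf`.
Moreover, for `0 ≤ k ≤ m-2` the inclusion
`⟨Pf^{-2k}⟩_𝒟 ↪ ⟨Pf^{-2k-2}⟩_𝒟` is the direct limit of the inclusions
`𝒩_{k,e} ⊆ 𝒩_{k+1,e}`.  Here `δ` is the family of partial derivatives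
extended to `S_Pf`. -/
theorem dSpan_pf_eq_iSup_NMod
    (m : ℕ) (hm : 1 ≤ m) (n : ℕ) (hn : n = 2 * m)
    (δ : SkewIdx n → Derivation ℂ (SPf n) (SPf n)) (hδ : IsDerivExtension n δ)
    (k : ℕ) (hk : k < m) :
    dSpan n δ (pfInv n ^ (2 * k)) = (⨆ e : ℕ, NMod n k (e + 1)) ∧
    (k + 2 ≤ m →
      (∀ e : ℕ, 1 ≤ e → NMod n k e ≤ NMod n (k + 1) e) ∧
      dSpan n δ (pfInv n ^ (2 * k)) ≤ dSpan n δ (pfInv n ^ (2 * (k + 1)))) := by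
  obtain ⟨m, rfl⟩ : ∃ m', m = m' + 1 := ⟨m - 1, by omega⟩
  subst hn
  refine ⟨dSpan_main (r := m - k) δ hδ (by omega), fun h => ⟨fun e _ => ?_, dSpan_mono k δ⟩⟩
  exact NMod_mono (r := m - k - 1) δ hδ (by omega) e

end SkewLC
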